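/- arXiv:0710.2233 — 4 statements merged into one kernel-verified Lean document; each statement's English description precedes it below -/
import Mathlib

section
/- Let m > 1 be an integer and let μ, ν be distinct roots of unity in ℂ, both not equal to 1, and such that ν ≠ μ⁻¹ whenever m is odd. If (1 - ν^m)(1 - μ)^m = (1 - μ^m)(1 - ν)^m, then μ^m = 1 and ν^m = 1. -/
/-- A root of unity: a complex number `z` with `z ^ n = 1` for some positive integer `n`. -/
def IsRootOfUnity (z : ℂ) : Prop := ∃ n : ℕ, 0 < n ∧ z ^ n = 1

def BE (m : ℕ) (μ ν : ℂ) : Prop := (1 - ν ^ m) * (1 - μ) ^ m = (1 - μ ^ m) * (1 - ν) ^ m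

lemma be_galois {m L k : ℕ} {μ ν : ℂ} (hL : 0 < L) (hμ : μ ^ L = 1) (hν : ν ^ L = 1)
    (hk : k.Coprime L) (h : BE m μ ν) : BE m (μ ^ k) (ν ^ k) := by
  have hζ := Complex.isPrimitiveRoot_exp L hL.ne'
  set ζ := Complex.exp (2 * Real.pi * Complex.I / L) with hζd
  have : NeZero L := ⟨hL.ne'⟩
  obtain ⟨a, -, rfl⟩ := hζ.eq_pow_of_pow_eq_one hμ
  obtain ⟨b, -, rfl⟩ := hζ.eq_pow_of_pow_eq_one hν
  let P : Polynomial ℤ := (1 - (Polynomial.X ^ b) ^ m) * (1 - Polynomial.X ^ a) ^ m -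
    (1 - (Polynomial.X ^ a) ^ m) * (1 - Polynomial.X ^ b) ^ m
  have hP : Polynomial.aeval ζ P = 0 := by
    unfold BE at h
    simp [P, h]
  have h1 : minpoly ℤ ζ ∣ P := minpoly.isIntegrallyClosed_dvd (hζ.isIntegral hL) hP
  rw [hζ.minpoly_eq_pow_coprime hk] at h1
  have h2 : Polynomial.aeval (ζ ^ k) P = 0 := by
    obtain ⟨Q, hQ⟩ := h1
    rw [hQ]; simp
  have h3 : BE m ((ζ ^ k) ^ a) ((ζ ^ k) ^ b) := by
    unfold BE
    simpa [P, sub_eq_zero] using h2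
  rwa [← pow_mul, ← pow_mul, mul_comm k, mul_comm k, pow_mul, pow_mul] at h3

lemma be_norm_exp (n j : ℕ) (hn : 0 < n) (hj : j ≤ n) :
    ‖1 - Complex.exp (2 * Real.pi * Complex.I / n) ^ j‖ = 2 * Real.sin (j * (Real.pi / n)) := by
  rw [norm_sub_rev, ← Complex.exp_nat_mul]
  have : (j : ℂ) * (2 * Real.pi * Complex.I / n) =
      Complex.I * ((2 * (j * (Real.pi / n)) : ℝ) : ℂ) := by
    push_cast; ring
  rw [this, Complex.norm_exp_I_mul_ofReal_sub_one]
  rw [mul_div_cancel_left₀ _ (two_ne_zero), Real.norm_of_nonneg]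
  have hn' : (0 : ℝ) < n := by exact_mod_cast hn
  have : 0 ≤ Real.sin (j * (Real.pi / n)) := by
    apply Real.sin_nonneg_of_nonneg_of_le_pi
    · positivity
    · rw [← mul_div_assoc, div_le_iff₀ hn', mul_comm]
      have : (j : ℝ) ≤ n := by exact_mod_cast hj
      gcongr
  linarith

lemma be_geom (j : ℕ) (z : ℂ) (hz : ‖z‖ = 1) : ‖1 - z ^ j‖ ≤ j * ‖1 - z‖ := by
  rw [← mul_neg_geom_sum z j, norm_mul, mul_comm]
  gcongr
  refine (norm_sum_le _ _).trans ?_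
  simp [hz]

lemma be_arch {n m j : ℕ} (hm : 2 ≤ m) (hj : 2 ≤ j) (hjn : 2 * j ≤ n) (ζ : ℂ)
    (hζ : ζ = Complex.exp (2 * Real.pi * Complex.I / n)) (h1 : ζ ^ m ≠ 1)
    (h2 : (ζ ^ j) ^ m ≠ 1) :
    ‖1 - (ζ ^ j) ^ m‖ * ‖1 - ζ‖ ^ m < ‖1 - ζ ^ m‖ * ‖1 - ζ ^ j‖ ^ m := by
  have hn : 0 < n := by omega
  have hn' : (0 : ℝ) < n := by exact_mod_cast hn
  have hj' : (2 : ℝ) ≤ j := by exact_mod_cast hj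
  have hjn' : (2 : ℝ) * j ≤ n := by exact_mod_cast hjn
  have hprim : IsPrimitiveRoot ζ n := hζ ▸ Complex.isPrimitiveRoot_exp n hn.ne'
  have hnorm : ‖ζ‖ = 1 := hprim.norm'_eq_one hn.ne'
  have hpi := Real.pi_pos
  have e1 : ‖1 - ζ‖ = 2 * Real.sin (Real.pi / n) := by
    have := be_norm_exp n 1 hn (by omega)
    rw [← hζ] at this; simpa using this
  have e2 : ‖1 - ζ ^ j‖ = 2 * Real.sin (j * (Real.pi / n)) := by
    rw [hζ]; exact be_norm_exp n j hn (by omega)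
  have hle : ‖1 - (ζ ^ j) ^ m‖ ≤ j * ‖1 - ζ ^ m‖ := by
    rw [← pow_mul, mul_comm, pow_mul]
    exact be_geom j _ (by simp [hnorm])
  have hpos : 0 < ‖1 - ζ ^ m‖ := by
    rw [norm_pos_iff, sub_ne_zero]; exact h1.symm
  set α := Real.pi / n with hα
  have hα0 : 0 < α := by positivity
  have hjα : j * α ≤ Real.pi / 2 := by
    rw [hα, ← mul_div_assoc, div_le_div_iff₀ hn' two_pos]
    nlinarith
  have hs : 0 < Real.sin α := Real.sin_pos_of_pos_of_lt_pi hα0 (by nlinarith)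
  -- the key: with U = sin jα / sin α, U^m > j
  suffices key : (j : ℝ) * Real.sin α ^ m < Real.sin (j * α) ^ m by
    rw [e1, e2, mul_pow, mul_pow]
    calc _ ≤ (j * ‖1 - ζ ^ m‖) * (2 ^ m * Real.sin α ^ m) := by gcongr
      _ = ‖1 - ζ ^ m‖ * (2 ^ m * (j * Real.sin α ^ m)) := by ring
      _ < _ := by gcongr
  have red : ∀ r : ℕ, r ≤ m → Real.sin α ≤ Real.sin (j * α) →
      (j : ℝ) * Real.sin α ^ r < Real.sin (j * α) ^ r →
      (j : ℝ) * Real.sin α ^ m < Real.sin (j * α) ^ m := by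
    intro r hr h0 h
    obtain ⟨t, rfl⟩ := Nat.exists_eq_add_of_le hr
    have : Real.sin α ^ t ≤ Real.sin (j * α) ^ t := by gcongr
    have h3 : 0 < Real.sin α ^ t := by positivity
    rw [pow_add, pow_add]
    have h5 : 0 < Real.sin α ^ r := by positivity
    have h6 : 0 ≤ Real.sin (j * α) ^ r := pow_nonneg (hs.le.trans h0) r
    calc (j : ℝ) * (Real.sin α ^ r * Real.sin α ^ t)
        = ((j : ℝ) * Real.sin α ^ r) * Real.sin α ^ t := by ring
      _ < Real.sin (j * α) ^ r * Real.sin α ^ t := by gcongr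
      _ ≤ Real.sin (j * α) ^ r * Real.sin (j * α) ^ t := by gcongr
  have hmono : Real.sin α ≤ Real.sin (j * α) :=
    Real.sin_le_sin_of_le_of_le_pi_div_two (by linarith) hjα (by nlinarith)
  by_cases hj3 : 3 ≤ j
  · have hj3' : (3 : ℝ) ≤ j := by exact_mod_cast hj3
    apply red 2 hm hmono
    have a1 : 2 / Real.pi * (j * α) ≤ Real.sin (j * α) := Real.mul_le_sin (by positivity) hjα
    have a2 : Real.sin α ≤ α := Real.sin_le hα0.le
    have a3 : 2 / Real.pi * (j * Real.sin α) ≤ Real.sin (j * α) := le_trans (by gcongr) a1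
    have a4 : (2 / Real.pi * (j * Real.sin α)) ^ 2 ≤ Real.sin (j * α) ^ 2 := by gcongr
    refine lt_of_lt_of_le ?_ a4
    have : (2 / Real.pi * (j * Real.sin α)) ^ 2 = (4 * j ^ 2 / Real.pi ^ 2) * Real.sin α ^ 2 := by
      field_simp; ring
    rw [this]
    have : (j : ℝ) < 4 * j ^ 2 / Real.pi ^ 2 := by
      rw [lt_div_iff₀ (by positivity)]
      have : Real.pi ^ 2 < 12 := by
        nlinarith [Real.pi_lt_d2]
      nlinarith
    gcongr
  · have hj2 : j = 2 := by omega
    subst hj2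
    have hsin : Real.sin ((2 : ℕ) * α) = 2 * Real.sin α * Real.cos α := by
      push_cast; exact Real.sin_two_mul α
    by_cases hn5 : 5 ≤ n
    · apply red 2 hm hmono
      rw [hsin]
      have hn5' : (5 : ℝ) ≤ n := by exact_mod_cast hn5
      have hc : 0 < Real.cos (2 * α) := by
        apply Real.cos_pos_of_mem_Ioo
        constructor
        · linarith
        · rw [hα, ← mul_div_assoc, div_lt_div_iff₀ hn' two_pos]
          nlinarith
      rw [Real.cos_two_mul] at hc
      have : 0 < Real.sin α ^ 2 := by positivity
      push_cast
      nlinarith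
    · have hn4 : n = 4 := by omega
      have hm3 : 3 ≤ m := by
        by_contra hcon
        have : m = 2 := by omega
        subst this
        apply h2
        rw [← pow_mul]
        have := hprim.pow_eq_one
        rw [hn4] at this
        exact this
      apply red 3 hm3 hmono
      rw [hsin]
      have hα4 : α = Real.pi / 4 := by rw [hα, hn4]; norm_num
      rw [hα4, Real.sin_pi_div_four, Real.cos_pi_div_four]
      have q : Real.sqrt 2 ^ 2 = 2 := Real.sq_sqrt (by norm_num)
      have q1 : 0 < Real.sqrt 2 := by positivity
      have q2 : Real.sqrt 2 < 2 := by nlinarith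
      have e : 2 * (Real.sqrt 2 / 2) * (Real.sqrt 2 / 2) = 1 := by nlinarith
      rw [e]
      have : (Real.sqrt 2 / 2) ^ 3 = Real.sqrt 2 / 4 := by
        rw [div_pow, pow_succ, q]; ring
      rw [this]; push_cast; linarith

lemma be_inj {k n : ℕ} (hk : k.Coprime n) {x : ℂ} (h1 : x ^ k = 1) (h2 : x ^ n = 1) : x = 1 := by
  have := pow_gcd_eq_one.2 ⟨h1, h2⟩
  rw [hk] at this; simpa using this

lemma be_A {n m : ℕ} {μ ν : ℂ} (hm : 2 ≤ m) (hn : 0 < n) (hμ : IsPrimitiveRoot μ n) (hν : ν ^ n = 1)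
    (hν1 : ν ≠ 1) (hμm : μ ^ m ≠ 1) (hνm : ν ^ m ≠ 1) (h : BE m μ ν) : ν = μ ∨ ν = μ⁻¹ := by
  have : NeZero n := ⟨hn.ne'⟩
  have hζ := Complex.isPrimitiveRoot_exp n hn.ne'
  obtain ⟨ζ, hζd⟩ : ∃ ζ, ζ = Complex.exp (2 * Real.pi * Complex.I / n) := ⟨_, rfl⟩
  rw [← hζd] at hζ
  obtain ⟨k, -, hk, hkζ⟩ := hμ.isPrimitiveRoot_iff.1 hζ
  have hg := be_galois hn hμ.pow_eq_one hν hk h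
  have hνk : (ν ^ k) ^ n = 1 := by rw [← pow_mul, mul_comm, pow_mul, hν, one_pow]
  obtain ⟨j, hjn, hj⟩ := hζ.eq_pow_of_pow_eq_one hνk
  have hμ0 : μ ≠ 0 := hμ.ne_zero hn.ne'
  have hζ0 : ζ ≠ 0 := hζ.ne_zero hn.ne'
  have pw : ∀ x : ℂ, (x ^ k) ^ m = (x ^ m) ^ k := fun x => by rw [← pow_mul, mul_comm, pow_mul]
  have nn : ∀ x : ℂ, x ^ n = 1 → x ^ m ≠ 1 → (x ^ k) ^ m ≠ 1 := by
    intro x hx hxm hc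
    rw [pw] at hc
    exact hxm (be_inj hk hc (by rw [← pow_mul, mul_comm, pow_mul, hx, one_pow]))
  have hζm := nn μ hμ.pow_eq_one hμm
  have hjm := nn ν hν hνm
  rw [← hj, hkζ] at hg
  rw [hkζ] at hζm
  rw [← hj] at hjm
  have hnorm : ‖ζ‖ = 1 := hζ.norm'_eq_one hn.ne'
  have hg' : ‖1 - (ζ ^ j) ^ m‖ * ‖1 - ζ‖ ^ m = ‖1 - ζ ^ m‖ * ‖1 - ζ ^ j‖ ^ m := by
    have := congrArg norm hg
    simpa using this
  have hj0 : j ≠ 0 := by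
    rintro rfl
    simp at hjm
  rcases Nat.lt_or_ge j 2 with h2 | h2
  · left
    have : j = 1 := by omega
    subst this
    have : (ν / μ) = 1 := by
      apply be_inj hk
      · rw [div_pow, hkζ, ← hj, pow_one, div_self hζ0]
      · rw [div_pow, hν, hμ.pow_eq_one, div_one]
    rwa [div_eq_one_iff_eq hμ0] at this
  rcases Nat.lt_or_ge n (2 * j) with h3 | h3
  · have hinv : ζ ^ (n - j) = (ζ ^ j)⁻¹ := by
      apply eq_inv_of_mul_eq_one_left
      rw [← pow_add, Nat.sub_add_cancel hjn.le, hζ.pow_eq_one]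
    have hsym : ∀ x : ℂ, ‖x‖ = 1 → ‖1 - x⁻¹‖ = ‖1 - x‖ := by
      intro x hx
      have hx0 : x ≠ 0 := by rintro rfl; simp at hx
      have : 1 - x⁻¹ = -(1 - x) * x⁻¹ := by field_simp; ring
      rw [this, norm_mul, norm_neg, norm_inv, hx]; simp
    rcases Nat.lt_or_ge (n - j) 2 with h4 | h4
    · right
      have e : n - j = 1 := by omega
      rw [e, pow_one] at hinv
      have : ν * μ = 1 := by
        apply be_inj hk
        · rw [mul_pow, hkζ, ← hj, ← pow_succ, show j + 1 = n by omega, hζ.pow_eq_one]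
        · rw [mul_pow, hν, hμ.pow_eq_one, one_mul]
      exact eq_inv_of_mul_eq_one_left this
    · exfalso
      have := be_arch hm h4 (by omega) ζ hζd hζm (by rw [hinv, inv_pow]; simpa using hjm)
      rw [hinv, inv_pow, hsym _ (by simp [hnorm]), hsym _ (by simp [hnorm])] at this
      exact absurd hg' this.ne
  · exact absurd hg' (be_arch hm h2 h3 ζ hζd hζm hjm).ne

lemma be_mod {n a b : ℕ} {x : ℂ} (hx : x ^ n = 1) (h : a ≡ b [MOD n]) : x ^ a = x ^ b := by
  rw [pow_eq_pow_mod a hx, pow_eq_pow_mod b hx, h]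

lemma be_B {n n' m k : ℕ} {μ ν : ℂ} (hm : 2 ≤ m) (hn : 0 < n) (hn' : 0 < n')
    (hμ : IsPrimitiveRoot μ n) (hν : IsPrimitiveRoot ν n') (hμ1 : μ ≠ 1)
    (hμm : μ ^ m ≠ 1) (hνm : ν ^ m ≠ 1) (h : BE m μ ν) (hk : k.Coprime n)
    (hkd : k ≡ 1 [MOD n.gcd n']) : μ ^ k = μ ∨ μ ^ k = μ⁻¹ := by
  obtain ⟨k', hk1, hk2⟩ := Nat.chineseRemainder' hkd
  have c1 : k'.Coprime n := by
    have := hk1.gcd_eq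
    rw [Nat.Coprime, this]; exact hk
  have c2 : k'.Coprime n' := by
    have := hk2.gcd_eq
    rw [Nat.Coprime, this]; simp
  have c3 : k'.Coprime (n * n') := c1.mul_right c2
  have hg := be_galois (k := k') (by positivity) (by rw [pow_mul, hμ.pow_eq_one, one_pow])
    (by rw [mul_comm, pow_mul, hν.pow_eq_one, one_pow]) c3 h
  have e1 : μ ^ k' = μ ^ k := be_mod hμ.pow_eq_one hk1
  have e2 : ν ^ k' = ν := by
    rw [be_mod hν.pow_eq_one hk2, pow_one]
  rw [e1, e2] at hg
  have hpn : (μ ^ k) ^ n = 1 := by rw [← pow_mul, mul_comm, pow_mul, hμ.pow_eq_one, one_pow]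
  apply be_A hm hn hμ hpn
  · intro hc; exact hμ1 (be_inj hk hc hμ.pow_eq_one)
  · exact hμm
  · intro hc
    rw [← pow_mul, mul_comm, pow_mul] at hc
    exact hμm (be_inj hk hc (by rw [← pow_mul, mul_comm, pow_mul, hμ.pow_eq_one, one_pow]))
  · unfold BE at *
    apply mul_left_cancel₀ (sub_ne_zero.2 hνm.symm)
    linear_combination (1 - (μ ^ k) ^ m) * h - (1 - μ ^ m) * hg

lemma be_count {n d : ℕ} (hn : 0 < n) (hd : d ∣ n)
    (H : ∀ k : ℕ, k.Coprime n → k ≡ 1 [MOD d] → (k : ZMod n) = 1 ∨ (k : ZMod n) = -1) :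
    n.totient ≤ 2 * d.totient ∧ (d.totient < n.totient → d ∣ 2) := by
  have : NeZero n := ⟨hn.ne'⟩
  have hd0 : 0 < d := Nat.pos_of_dvd_of_pos hd hn
  have : NeZero d := ⟨hd0.ne'⟩
  have hc := (ZMod.unitsMap hd).ker.card_mul_index
  rw [Subgroup.index_ker, MonoidHom.range_eq_top.2 (ZMod.unitsMap_surjective hd)] at hc
  simp only [Subgroup.card_top, Nat.card_eq_fintype_card (α := (ZMod _)ˣ), ZMod.card_units_eq_totient] at hc
  have hker : ∀ u ∈ (ZMod.unitsMap hd).ker, u = 1 ∨ u = -1 := by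
    intro u hu
    have h1 : (((u : ZMod n).val : ℕ) : ZMod n) = u := ZMod.natCast_zmod_val _
    have := H (u : ZMod n).val (ZMod.val_coe_unit_coprime u) (by
      rw [← ZMod.natCast_eq_natCast_iff]
      have h2 := congrArg Units.val (MonoidHom.mem_ker.1 hu)
      rw [ZMod.unitsMap_val] at h2
      rw [ZMod.natCast_val, h2]; simp)
    rw [h1] at this
    rcases this with h | h
    · left; ext; simpa using h
    · right; ext; simpa using h
  have hsub : ((ZMod.unitsMap hd).ker : Set (ZMod n)ˣ) ⊆ (({1, -1} : Finset (ZMod n)ˣ) : Set _) := by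
    intro u hu
    simpa using hker u hu
  have hcard : Nat.card (ZMod.unitsMap hd).ker ≤ 2 := by
    have := Set.ncard_le_ncard hsub (Finset.finite_toSet _)
    rw [Set.ncard_coe_finset] at this
    exact (this.trans Finset.card_le_two)
  constructor
  · rw [← hc]; gcongr
  · intro hlt
    have : 1 < Nat.card (ZMod.unitsMap hd).ker := by
      by_contra hcon
      have : Nat.card (ZMod.unitsMap hd).ker * d.totient ≤ 1 * d.totient := by gcongr; omega
      omega
    have := Finite.one_lt_card_iff_nontrivial.1 this
    obtain ⟨⟨u, hu⟩, hu1⟩ := exists_ne (1 : (ZMod.unitsMap hd).ker)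
    have hu2 : u ≠ 1 := fun h => hu1 (by ext; simp [h])
    have hu3 := (hker u hu).resolve_left hu2
    subst hu3
    have h2 := congrArg Units.val (MonoidHom.mem_ker.1 hu)
    rw [ZMod.unitsMap_val] at h2
    have h3 : (-1 : ZMod d) = 1 := by
      simpa [ZMod.cast_neg hd, ZMod.cast_one hd] using h2
    have : ((2 : ℕ) : ZMod d) = 0 := by push_cast; linear_combination -h3
    exact (ZMod.natCast_eq_zero_iff _ _).1 this

lemma be_tot {e : ℕ} (h : e.totient ≤ 2) : e ≤ 6 := by
  by_contra hcon
  have hk : ∃ k, 1 < k ∧ k < e - 1 ∧ Nat.Coprime e k := by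
    rcases Nat.even_or_odd e with he | he
    · obtain ⟨c, hc⟩ := he
      rcases Nat.even_or_odd c with hc' | hc'
      · obtain ⟨t, ht⟩ := hc'
        refine ⟨2 * t + 1, by omega, by omega, ?_⟩
        rw [← Nat.isCoprime_iff_coprime]
        refine ⟨t, 1 - 2 * t, ?_⟩
        subst hc ht; push_cast; ring
      · obtain ⟨t, ht⟩ := hc'
        refine ⟨2 * t + 3, by omega, by omega, ?_⟩
        rw [← Nat.isCoprime_iff_coprime]
        refine ⟨(t + 1) * (t + 2), 1 - 2 * (t + 1) ^ 2, ?_⟩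
        subst hc ht; push_cast; ring
    · exact ⟨2, by omega, by omega, he.coprime_two_right⟩
  obtain ⟨k, hk1, hk2, hk3⟩ := hk
  have hs : ({1, k, e - 1} : Finset ℕ) ⊆ (Finset.range e).filter e.Coprime := by
    intro x hx
    simp only [Finset.mem_insert, Finset.mem_singleton] at hx
    simp only [Finset.mem_filter, Finset.mem_range]
    rcases hx with rfl | rfl | rfl
    · exact ⟨by omega, by simp⟩
    · exact ⟨by omega, hk3⟩
    · refine ⟨by omega, ?_⟩
      rw [Nat.coprime_self_sub_right (by omega)]; simp
  have hc := Finset.card_le_card hs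
  rw [Finset.card_eq_three.2 ⟨1, k, e - 1, by omega, by omega, by omega, rfl⟩] at hc
  have h' : (Finset.filter e.Coprime (Finset.range e)).card ≤ 2 := h
  omega

lemma be_T3 {x : ℂ} (h : x ^ 3 = 1) (h1 : x ≠ 1) : (1 - x) * (1 - x⁻¹) = 3 := by
  have hi : x⁻¹ = x ^ 2 := inv_eq_of_mul_eq_one_left (by rw [← h]; ring)
  have h2 : x ^ 2 + x + 1 = 0 := by
    apply mul_left_cancel₀ (sub_ne_zero.2 h1)
    linear_combination h
  rw [hi]; linear_combination h - h2

lemma be_T4 {x : ℂ} (h : x ^ 2 = -1) : (1 - x) * (1 - x⁻¹) = 2 := by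
  have hi : x⁻¹ = - x := inv_eq_of_mul_eq_one_left (by linear_combination -h)
  rw [hi]; linear_combination -h

lemma be_T6 {x : ℂ} (h : x ^ 2 - x + 1 = 0) : (1 - x) * (1 - x⁻¹) = 1 := by
  have hi : x⁻¹ = 1 - x := inv_eq_of_mul_eq_one_left (by linear_combination -h)
  rw [hi]; linear_combination -h

lemma be_T2 {x : ℂ} (h : x = -1) : (1 - x) * (1 - x⁻¹) = 4 := by
  rw [h]; norm_num

lemma be_T4' {x : ℂ} (h : x ^ 4 = 1) (h1 : x ≠ 1) :
    (1 - x) * (1 - x⁻¹) = 2 ∨ (1 - x) * (1 - x⁻¹) = 4 := by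
  have : (x + 1) * (x ^ 2 + 1) = 0 := by
    apply mul_left_cancel₀ (sub_ne_zero.2 h1)
    linear_combination h
  rcases mul_eq_zero.1 this with h | h
  · exact Or.inr (be_T2 (by linear_combination h))
  · exact Or.inl (be_T4 (by linear_combination h))

lemma be_T6' {x : ℂ} (h : x ^ 6 = 1) (h1 : x ≠ 1) :
    (1 - x) * (1 - x⁻¹) = 1 ∨ (1 - x) * (1 - x⁻¹) = 3 ∨ (1 - x) * (1 - x⁻¹) = 4 := by
  have : (x + 1) * ((x ^ 3 - 1) * (x ^ 2 - x + 1)) = 0 := by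
    linear_combination h
  rcases mul_eq_zero.1 this with h | h
  · exact Or.inr (Or.inr (be_T2 (by linear_combination h)))
  rcases mul_eq_zero.1 h with h | h
  · exact Or.inr (Or.inl (be_T3 (by linear_combination h) h1))
  · exact Or.inl (be_T6 h)

lemma be_prod {m : ℕ} {μ ν : ℂ} (hμ : ‖μ‖ = 1) (hν : ‖ν‖ = 1) (h : BE m μ ν) :
    ((1 - ν ^ m) * (1 - (ν ^ m)⁻¹)) * ((1 - μ) * (1 - μ⁻¹)) ^ m =
    ((1 - μ ^ m) * (1 - (μ ^ m)⁻¹)) * ((1 - ν) * (1 - ν⁻¹)) ^ m := by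
  have h2 := congrArg (starRingEnd ℂ) h
  simp only [map_mul, map_sub, map_pow, map_one] at h2
  rw [← Complex.inv_eq_conj hμ, ← Complex.inv_eq_conj hν] at h2
  unfold BE at h
  rw [mul_pow, mul_pow, ← inv_pow, ← inv_pow]
  calc _ = ((1 - ν ^ m) * (1 - μ) ^ m) * ((1 - ν⁻¹ ^ m) * (1 - μ⁻¹) ^ m) := by ring
    _ = _ := by rw [h, h2]; ring

lemma be_sq {x : ℂ} (h : IsPrimitiveRoot x 4) : x ^ 2 = -1 := by
  have h1 : x ^ 2 ≠ 1 := h.pow_ne_one_of_pos_of_lt (by norm_num) (by norm_num)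
  apply mul_left_cancel₀ (sub_ne_zero.2 h1)
  linear_combination h.pow_eq_one

lemma be_six {x : ℂ} (h : IsPrimitiveRoot x 6) : x ^ 2 - x + 1 = 0 := by
  have h1 : x ^ 2 ≠ 1 := h.pow_ne_one_of_pos_of_lt (by norm_num) (by norm_num)
  have h3 : x ^ 3 ≠ 1 := h.pow_ne_one_of_pos_of_lt (by norm_num) (by norm_num)
  have h4 : x + 1 ≠ 0 := fun hc => h1 (by linear_combination (x - 1) * hc)
  apply mul_left_cancel₀ (sub_ne_zero.2 h3)
  apply mul_left_cancel₀ h4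
  linear_combination h.pow_eq_one

lemma be_small {n n' m : ℕ} {μ ν : ℂ} (hm : 2 ≤ m)
    (hμ : IsPrimitiveRoot μ n) (hν : IsPrimitiveRoot ν n')
    (hμm : μ ^ m ≠ 1) (hνm : ν ^ m ≠ 1) (h : BE m μ ν)
    (hc : (n = 3 ∧ n' = 2) ∨ (n = 3 ∧ n' = 4) ∨ (n = 6 ∧ n' = 4)) : False := by
  have hp := be_prod (hμ.norm'_eq_one (by omega)) (hν.norm'_eq_one (by omega)) h
  have hpm : ∀ (x : ℂ) (r : ℕ), x ^ r = 1 → (x ^ m) ^ r = 1 := fun x r hx => by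
    rw [← pow_mul, mul_comm, pow_mul, hx, one_pow]
  obtain ⟨t, rfl⟩ := Nat.exists_eq_add_of_le hm
  rcases hc with ⟨rfl, rfl⟩ | ⟨rfl, rfl⟩ | ⟨rfl, rfl⟩
  · have hν1 : ν = -1 := hν.eq_neg_one_of_two_right
    have hν2 : ν ^ (2 + t) = -1 := by
      have := hpm ν 2 hν.pow_eq_one
      exact (mul_self_eq_one_iff.1 (by rw [← sq]; exact this)).resolve_left hνm
    rw [be_T2 hν1, be_T2 hν2, be_T3 (hpm μ 3 hμ.pow_eq_one) hμm,
      be_T3 hμ.pow_eq_one (hμ.ne_one (by norm_num))] at hp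
    have : 4 * 3 ^ (2 + t) = 3 * 4 ^ (2 + t) := by exact_mod_cast hp
    have h3 : 3 ^ (1 + t) < 4 ^ (1 + t) := Nat.pow_lt_pow_left (by norm_num) (by omega)
    have e3 : 3 ^ (2 + t) = 3 * 3 ^ (1 + t) := by ring
    have e4 : 4 ^ (2 + t) = 4 * 4 ^ (1 + t) := by ring
    omega
  · rw [be_T4 (be_sq hν), be_T3 (hpm μ 3 hμ.pow_eq_one) hμm,
      be_T3 hμ.pow_eq_one (hμ.ne_one (by norm_num))] at hp
    have h3 : 2 ^ (2 + t) < 3 ^ (2 + t) := Nat.pow_lt_pow_left (by norm_num) (by omega)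
    have e3 : 3 ^ (2 + t) = 3 * (3 * 3 ^ t) := by ring
    have h4 : ¬ 3 ∣ 2 ^ (2 + t) := fun hd => by
      have := Nat.prime_three.dvd_of_dvd_pow hd
      omega
    rcases be_T4' (hpm ν 4 hν.pow_eq_one) hνm with hT | hT
    · rw [hT] at hp
      have : 2 * 3 ^ (2 + t) = 3 * 2 ^ (2 + t) := by exact_mod_cast hp
      omega
    · rw [hT] at hp
      have : 4 * 3 ^ (2 + t) = 3 * 2 ^ (2 + t) := by exact_mod_cast hp
      omega
  · rw [be_T4 (be_sq hν), be_T6 (be_six hμ), one_pow, mul_one] at hp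
    rcases Nat.eq_zero_or_pos t with rfl | ht
    · rw [be_T3 (x := μ ^ (2 + 0)) (by rw [← pow_mul]; exact hμ.pow_eq_one) hμm] at hp
      rcases be_T4' (hpm ν 4 hν.pow_eq_one) hνm with hT | hT <;> rw [hT] at hp <;> norm_num at hp
    · have h3 : 2 ^ 1 ≤ 2 ^ t := Nat.pow_le_pow_right (by norm_num) ht
      have e3 : 2 ^ (2 + t) = 4 * 2 ^ t := by ring
      have key : ∀ c c' : ℕ, c ≤ 4 → 1 ≤ c' → (c : ℂ) = c' * 2 ^ (2 + t) → False := by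
        intro c c' h1 h2 h3
        have : c = c' * 2 ^ (2 + t) := by exact_mod_cast h3
        nlinarith
      rcases be_T4' (hpm ν 4 hν.pow_eq_one) hνm with hT | hT <;>
      rcases be_T6' (hpm μ 6 hμ.pow_eq_one) hμm with hS | hS | hS <;>
      rw [hT, hS] at hp
      · exact key 2 1 (by norm_num) (by norm_num) (by exact_mod_cast hp)
      · exact key 2 3 (by norm_num) (by norm_num) (by exact_mod_cast hp)
      · exact key 2 4 (by norm_num) (by norm_num) (by exact_mod_cast hp)
      · exact key 4 1 (by norm_num) (by norm_num) (by exact_mod_cast hp)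
      · exact key 4 3 (by norm_num) (by norm_num) (by exact_mod_cast hp)
      · exact key 4 4 (by norm_num) (by norm_num) (by exact_mod_cast hp)

lemma be_cnt {n n' m : ℕ} {μ ν : ℂ} (hm : 2 ≤ m) (hn : 0 < n) (hn' : 0 < n')
    (hμ : IsPrimitiveRoot μ n) (hν : IsPrimitiveRoot ν n') (hμ1 : μ ≠ 1)
    (hμm : μ ^ m ≠ 1) (hνm : ν ^ m ≠ 1) (h : BE m μ ν) :
    n.totient ≤ 2 * (n.gcd n').totient ∧
      ((n.gcd n').totient < n.totient → n.gcd n' ∣ 2) := by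
  apply be_count hn (Nat.gcd_dvd_left _ _)
  intro k hk hkd
  rcases be_B hm hn hn' hμ hν hμ1 hμm hνm h hk hkd with h1 | h1
  · left
    have h2 : μ ^ k = μ ^ 1 := by rw [h1, pow_one]
    have : k ≡ 1 [MOD n] := by
      rw [hμ.eq_orderOf]
      exact (IsOfFinOrder.pow_eq_pow_iff_modEq (hμ.isOfFinOrder hn.ne')).1 h2
    simpa using (ZMod.natCast_eq_natCast_iff _ _ _).2 this
  · right
    have h2 : μ ^ (k + 1) = 1 := by
      rw [pow_succ, h1, inv_mul_cancel₀ (hμ.ne_zero hn.ne')]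
    have := (ZMod.natCast_eq_zero_iff _ _).2 ((hμ.pow_eq_one_iff_dvd _).1 h2)
    push_cast at this
    linear_combination this

lemma be_half {n n' m : ℕ} {μ ν : ℂ} (hm : 2 ≤ m) (hn : 0 < n) (hn' : 0 < n')
    (hμ : IsPrimitiveRoot μ n) (hν : IsPrimitiveRoot ν n') (hμ1 : μ ≠ 1) (hν1 : ν ≠ 1)
    (hμm : μ ^ m ≠ 1) (hνm : ν ^ m ≠ 1) (h : BE m μ ν) (h1 : ¬ n ∣ n') (h2 : ¬ n' ∣ n)
    (hodd : Odd (n / n.gcd n')) : False := by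
  obtain ⟨a1, a2⟩ := be_cnt hm hn hn' hμ hν hμ1 hμm hνm h
  obtain ⟨b1, -⟩ := be_cnt hm hn' hn hν hμ hν1 hνm hμm h.symm
  rw [Nat.gcd_comm] at b1
  have hd : 0 < n.gcd n' := Nat.gcd_pos_of_pos_left _ hn
  have hcop := Nat.coprime_div_gcd_div_gcd hd
  have en := Nat.mul_div_cancel' (Nat.gcd_dvd_left n n')
  have en' := Nat.mul_div_cancel' (Nat.gcd_dvd_right n n')
  generalize n.gcd n' = d at *
  generalize n / d = e at *
  generalize n' / d = e' at *
  have hφ : 0 < d.totient := Nat.totient_pos.2 hd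
  have s1 := Nat.totient_super_multiplicative d e
  have s2 := Nat.totient_super_multiplicative d e'
  rw [en] at s1
  rw [en'] at s2
  have t1 : e.totient ≤ 2 := by nlinarith
  have t2 : e'.totient ≤ 2 := by nlinarith
  have t3 := be_tot t1
  have t4 := be_tot t2
  have f1 : e ≠ 1 := by rintro rfl; apply h1; rw [← en, ← en']; simp
  have f2 : e' ≠ 1 := by rintro rfl; apply h2; rw [← en, ← en']; simp
  have f3 : e = 3 := by
    interval_cases e
    all_goals first | rfl | (exfalso; revert hodd; decide) | (exfalso; revert t1; decide) | omega
  subst f3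
  have f4 : e' = 2 ∨ e' = 4 := by
    interval_cases e'
    all_goals first | omega | (exfalso; revert hcop; decide) | (exfalso; revert t2; decide)
  have hd2 : d ∣ 2 := by
    apply a2
    have : Nat.totient 3 = 2 := by decide
    rw [this] at s1; omega
  have hd3 : d ≤ 2 := Nat.le_of_dvd two_pos hd2
  apply be_small hm hμ hν hμm hνm h
  subst en en'
  rcases f4 with rfl | rfl
  · interval_cases d
    · simp
    · simp
  · interval_cases d
    · simp
    · exfalso; revert b1; decide

theorem be_core {m : ℕ} {μ ν : ℂ} (hm : 2 ≤ m) (hμ : IsRootOfUnity μ) (hν : IsRootOfUnity ν)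
    (hμ1 : μ ≠ 1) (hν1 : ν ≠ 1) (hμm : μ ^ m ≠ 1) (hνm : ν ^ m ≠ 1) (h : BE m μ ν) :
    ν = μ ∨ ν = μ⁻¹ := by
  have o1 : 0 < orderOf μ := orderOf_pos_iff.2 (isOfFinOrder_iff_pow_eq_one.2 hμ)
  have o2 : 0 < orderOf ν := orderOf_pos_iff.2 (isOfFinOrder_iff_pow_eq_one.2 hν)
  have p1 := IsPrimitiveRoot.orderOf μ
  have p2 := IsPrimitiveRoot.orderOf ν
  generalize orderOf μ = n at *
  generalize orderOf ν = n' at *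
  by_cases h1 : n ∣ n'
  · rcases be_A hm o2 p2 ((p1.pow_eq_one_iff_dvd _).2 h1) hμ1 hνm hμm h.symm with h | h
    · exact Or.inl h.symm
    · right; rw [h, inv_inv]
  by_cases h2 : n' ∣ n
  · exact be_A hm o1 p1 ((p2.pow_eq_one_iff_dvd _).2 h2) hν1 hμm hνm h
  exfalso
  by_cases hodd : Odd (n / n.gcd n')
  · exact be_half hm o1 o2 p1 p2 hμ1 hν1 hμm hνm h h1 h2 hodd
  · apply be_half hm o2 o1 p2 p1 hν1 hμ1 hνm hμm h.symm h2 h1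
    rw [Nat.gcd_comm]
    have hcop := Nat.coprime_div_gcd_div_gcd (Nat.gcd_pos_of_pos_left n' o1)
    by_contra hc
    rw [Nat.not_odd_iff_even, even_iff_two_dvd] at hc hodd
    have := Nat.dvd_gcd hodd hc
    rw [hcop] at this
    omega

theorem beukers_diophantine_one (m : ℕ) (hm : 1 < m) (μ ν : ℂ)
    (hμ : IsRootOfUnity μ) (hν : IsRootOfUnity ν)
    (hne : μ ≠ ν) (hμ1 : μ ≠ 1) (hν1 : ν ≠ 1)
    (hodd : Odd m → ν ≠ μ⁻¹)
    (heq : (1 - ν ^ m) * (1 - μ) ^ m = (1 - μ ^ m) * (1 - ν) ^ m) :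
    μ ^ m = 1 ∧ ν ^ m = 1 := by
  have hx : (1 - μ) ^ m ≠ 0 := pow_ne_zero _ (sub_ne_zero.2 hμ1.symm)
  have hy : (1 - ν) ^ m ≠ 0 := pow_ne_zero _ (sub_ne_zero.2 hν1.symm)
  have hiff : μ ^ m = 1 ↔ ν ^ m = 1 := by
    constructor
    · intro h
      rw [h, sub_self, zero_mul] at heq
      exact (sub_eq_zero.1 ((mul_eq_zero.1 heq).resolve_right hx)).symm
    · intro h
      rw [h, sub_self, zero_mul] at heq
      exact (sub_eq_zero.1 ((mul_eq_zero.1 heq.symm).resolve_right hy)).symm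
  by_cases hμm : μ ^ m = 1
  · exact ⟨hμm, hiff.1 hμm⟩
  exfalso
  have hνm : ν ^ m ≠ 1 := fun h => hμm (hiff.2 h)
  rcases be_core hm hμ hν hμ1 hν1 hμm hνm heq with h | h
  · exact hne h.symm
  rcases Nat.even_or_odd m with he | ho
  · have hμ0 : μ ≠ 0 := by
      rintro rfl
      obtain ⟨n, hn, hn'⟩ := hμ
      rw [zero_pow hn.ne'] at hn'
      exact zero_ne_one hn'
    have e1 : (1 - ν) ^ m * μ ^ m = (1 - μ) ^ m := by
      rw [← mul_pow, h, sub_mul, inv_mul_cancel₀ hμ0, one_mul, ← he.neg_pow, neg_sub]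
    have e2 : ν ^ m * μ ^ m = 1 := by
      rw [← mul_pow, h, inv_mul_cancel₀ hμ0, one_pow]
    have e3 : (1 - μ ^ m) * (1 - μ) ^ m * 2 = 0 := by
      linear_combination (-μ ^ m) * heq - (1 - μ ^ m) * e1 - e2 * (1 - μ) ^ m
    have h0 : (1 - μ ^ m) ≠ 0 := sub_ne_zero.2 (Ne.symm hμm)
    exact mul_ne_zero (mul_ne_zero h0 hx) two_ne_zero e3
  · exact hodd ho h
end

section
/- Let m > 1 be an integer and let μ, ν be distinct roots of unity in ℂ, not both equal to 1, and such that ν ≠ μ⁻¹ whenever m is even. If (1 + ν^m)(1 - μ)^m = (1 + μ^m)(1 - ν)^m, then μ^m = -1 and ν^m = -1. -/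
open Polynomial

theorem sin_ge_aux {a x : ℝ} (ha : 0 ≤ a) (h1 : a ≤ x) (h2 : x ≤ Real.pi - a) :
    Real.sin a ≤ Real.sin x := by
  rcases le_total x (Real.pi / 2) with h | h
  · exact Real.sin_le_sin_of_le_of_le_pi_div_two (by linarith [Real.pi_pos]) h h1
  · rw [← Real.sin_pi_sub x]
    exact Real.sin_le_sin_of_le_of_le_pi_div_two (by linarith [Real.pi_pos]) (by linarith) (by linarith)

theorem norm_one_add_exp (t : ℝ) : ‖1 + Complex.exp (2 * t * Complex.I)‖ = 2 * |Real.cos t| := by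
  have h : 1 + Complex.exp (2 * t * Complex.I)
      = (2 * Real.cos t : ℝ) * Complex.exp (t * Complex.I) := by
    push_cast
    rw [Complex.cos, mul_div_cancel₀ _ (two_ne_zero), add_mul, ← Complex.exp_add, ← Complex.exp_add]
    have e1 : (t:ℂ) * Complex.I + t * Complex.I = 2 * t * Complex.I := by ring
    have e2 : -(t:ℂ) * Complex.I + t * Complex.I = 0 := by ring
    rw [e1, e2, Complex.exp_zero, add_comm]
  rw [h, norm_mul, Complex.norm_exp_ofReal_mul_I, Complex.norm_real, mul_one, Real.norm_eq_abs,
    abs_mul, abs_two]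

theorem norm_one_sub_exp (t : ℝ) : ‖1 - Complex.exp (2 * t * Complex.I)‖ = 2 * |Real.sin t| := by
  have h := Complex.norm_exp_I_mul_ofReal_sub_one (2 * t)
  rw [norm_sub_rev]
  have e : (2 * t * Complex.I : ℂ) = Complex.I * ((2 * t : ℝ) : ℂ) := by push_cast; ring
  rw [e, h]
  simp

theorem cos_lower (n m : ℕ) (hn : 0 < n) (h : Real.cos (m * (Real.pi / n)) ≠ 0) :
    Real.sin (Real.pi / (2 * n)) ≤ |Real.cos (m * (Real.pi / n))| := by
  have hn' : (0:ℝ) < n := by exact_mod_cast hn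
  set j : ℤ := n - 2 * m with hj
  have e : Real.cos (m * (Real.pi / n)) = Real.sin (j * (Real.pi / (2 * n))) := by
    rw [← Real.sin_pi_div_two_sub]
    congr 1
    rw [hj]; push_cast; field_simp
  have hpos : (0:ℤ) < 2 * n := by positivity
  have hdiv := Int.emod_add_mul_ediv j (2 * n)
  have h0 := Int.emod_nonneg j hpos.ne'
  have h1 := Int.emod_lt_of_pos j hpos
  set r := j % (2 * n)
  set q := j / (2 * n)
  have e2 : (j:ℝ) * (Real.pi / (2 * n)) = r * (Real.pi / (2 * n)) + q * Real.pi := by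
    rw [← hdiv]; push_cast; field_simp
  have e3 : |Real.cos (m * (Real.pi / n))| = |Real.sin (r * (Real.pi / (2 * n)))| := by
    rw [e, e2, Real.sin_add_int_mul_pi, abs_mul, abs_zpow]; simp
  rw [e3]
  have hr : r ≠ 0 := by
    intro hr
    rw [hr] at e3
    simp at e3
    exact h e3
  have hr1 : (1:ℝ) ≤ r := by exact_mod_cast (by omega : 1 ≤ r)
  have hr2 : (r:ℝ) + 1 ≤ 2 * n := by exact_mod_cast (by omega : r + 1 ≤ 2 * n)
  have ha : 0 < Real.pi / (2 * n) := by positivity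
  have hpi : 2 * n * (Real.pi / (2 * n)) = Real.pi := by field_simp
  refine le_trans (sin_ge_aux ha.le ?_ ?_) (le_abs_self _)
  · nlinarith
  · nlinarith

theorem pow_aux (m : ℕ) (hm : 4 ≤ m) : (3 * m : ℝ) < (1.87:ℝ) ^ m := by
  induction m, hm using Nat.le_induction with
  | base => norm_num
  | succ k hk ih =>
    rw [pow_succ]; push_cast
    have : (4:ℝ) ≤ k := by exact_mod_cast hk
    nlinarith

theorem numeric (n m : ℕ) (hn : 5 ≤ n) (hm : 3 ≤ m) (h : Real.cos (m * (Real.pi / n)) ≠ 0) :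
    1 < |Real.cos (m * (Real.pi / n))| * (2 * Real.cos (Real.pi / n)) ^ m := by
  have hpi := Real.pi_gt_d4
  have hpi2 := Real.pi_lt_d4
  have hn5 : (5:ℝ) ≤ n := by exact_mod_cast hn
  have hm3 : (3:ℝ) ≤ m := by exact_mod_cast hm
  have hn0 : (0:ℝ) < n := by linarith
  have cosb : ∀ k : ℝ, 0 < k → k ≤ n → 2 * (1 - (3.1416 / k)^2/2) ≤ 2 * Real.cos (Real.pi / n) := by
    intro k hk hkn
    have h1 := Real.one_sub_sq_div_two_le_cos (x := Real.pi / n)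
    have h2 : Real.pi / n ≤ 3.1416 / k := by
      gcongr
    have h3 : 0 ≤ Real.pi / n := by positivity
    have h4 : (Real.pi / n)^2 ≤ (3.1416 / k)^2 := by gcongr
    linarith
  have hc5 : 1.6 ≤ 2 * Real.cos (Real.pi / n) := by
    have := cosb 5 (by norm_num) hn5
    norm_num at this ⊢
    linarith
  have powb : ∀ c : ℝ, 1 ≤ c → c ≤ 2 * Real.cos (Real.pi / n) →
      c ^ 3 ≤ (2 * Real.cos (Real.pi / n)) ^ m := by
    intro c hc hc2
    calc c ^ 3 ≤ c ^ m := pow_le_pow_right₀ hc hm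
      _ ≤ _ := by gcongr
  by_cases h3 : 3 * m ≤ n
  · have h3' : (3 * m : ℝ) ≤ n := by exact_mod_cast h3
    have hh : (m:ℝ) * (Real.pi / n) ≤ Real.pi / 3 := by
      rw [← mul_div_assoc, div_le_div_iff₀ hn0 (by norm_num)]
      nlinarith
    have h2 : (1/2:ℝ) ≤ Real.cos (m * (Real.pi / n)) := by
      rw [← Real.cos_pi_div_three]
      apply Real.cos_le_cos_of_nonneg_of_le_pi (by positivity) (by linarith) hh
    have h4 := powb 1.6 (by norm_num) hc5
    have h5 : (1/2:ℝ) ≤ |Real.cos (m * (Real.pi / n))| := le_trans h2 (le_abs_self _)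
    norm_num at h4
    nlinarith
  have hlow := cos_lower n m (by omega) h
  by_cases h9 : 9 ≤ n
  · have hsin : 1 / (n:ℝ) ≤ Real.sin (Real.pi / (2 * n)) := by
      have := Real.mul_le_sin (x := Real.pi / (2 * n)) (by positivity) (by
        gcongr; linarith)
      refine le_trans (le_of_eq ?_) this
      field_simp
    have hnm : (n:ℝ) < 3 * m := by exact_mod_cast (by omega : n < 3 * m)
    have hc : 1.87 ≤ 2 * Real.cos (Real.pi / n) := by
      have := cosb 9 (by norm_num) (by exact_mod_cast h9)
      norm_num at this ⊢
      linarith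
    have h1 : (1.87:ℝ)^m ≤ (2 * Real.cos (Real.pi / n)) ^ m := by gcongr
    have h2 := pow_aux m (by omega)
    calc (1:ℝ) = 1 / n * n := by field_simp
      _ < 1 / n * (2 * Real.cos (Real.pi / n)) ^ m := by
        apply mul_lt_mul_of_pos_left _ (by positivity); linarith
      _ ≤ _ := by gcongr; linarith
  · have hs : ∀ (s c : ℝ), 0 < s → 1 ≤ c → s ≤ 3.1415 / (2*n) - (3.1416/(2*n))^3/6 →
        c ≤ 2 * (1 - (3.1416 / n)^2/2) → 1 < s * c^3 →
        1 < |Real.cos (m * (Real.pi / n))| * (2 * Real.cos (Real.pi / n)) ^ m := by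
      intro s c hs0 hc hs hc2 hsc
      have h1 := powb c hc (hc2.trans (cosb n hn0 le_rfl))
      have h2 : s ≤ Real.sin (Real.pi / (2 * n)) := by
        have hx : 0 < Real.pi / (2 * n) := by positivity
        have := Real.sin_ge_sub_cube hx.le
        have e1 : 3.1415 / (2*n) ≤ Real.pi / (2 * n) := by gcongr
        have e2 : (Real.pi / (2 * n))^3 ≤ (3.1416/(2*n))^3 := by gcongr
        linarith
      calc 1 < s * c^3 := hsc
        _ ≤ _ := by gcongr; linarith
    have : n = 5 ∨ n = 6 ∨ n = 7 ∨ n = 8 := by omega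
    rcases this with rfl | rfl | rfl | rfl
    · exact hs 0.3 1.6 (by norm_num) (by norm_num) (by norm_num) (by norm_num) (by norm_num)
    · exact hs 0.25 1.7 (by norm_num) (by norm_num) (by norm_num) (by norm_num) (by norm_num)
    · exact hs 0.22 1.78 (by norm_num) (by norm_num) (by norm_num) (by norm_num) (by norm_num)
    · exact hs 0.19 1.83 (by norm_num) (by norm_num) (by norm_num) (by norm_num) (by norm_num)

/-- The equation of the theorem. -/
def BkEq (m : ℕ) (μ ν : ℂ) : Prop := (1 + ν ^ m) * (1 - μ) ^ m = (1 + μ ^ m) * (1 - ν) ^ m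

theorem BkEq.symm {m : ℕ} {μ ν : ℂ} (h : BkEq m μ ν) : BkEq m ν μ := Eq.symm h

theorem BkEq.conj {m : ℕ} {μ ν : ℂ} (h : BkEq m μ ν) (N : ℕ) (hN : 0 < N) (h1 : μ ^ N = 1)
    (h2 : ν ^ N = 1) (k : ℕ) (hk : k.Coprime N) : BkEq m (μ ^ k) (ν ^ k) := by
  have : NeZero N := ⟨hN.ne'⟩
  have hz := Complex.isPrimitiveRoot_exp N hN.ne'
  set z := Complex.exp (2 * Real.pi * Complex.I / N)
  obtain ⟨a, -, rfl⟩ := hz.eq_pow_of_pow_eq_one h1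
  obtain ⟨b, -, rfl⟩ := hz.eq_pow_of_pow_eq_one h2
  let P : ℤ[X] := (1 + (X ^ b) ^ m) * (1 - X ^ a) ^ m - (1 + (X ^ a) ^ m) * (1 - X ^ b) ^ m
  have hP : aeval z P = 0 := by
    simp only [P, map_sub, map_mul, map_add, map_pow, aeval_X, map_one]
    exact sub_eq_zero.2 h
  obtain ⟨Q, hQ⟩ := minpoly.isIntegrallyClosed_dvd (hz.isIntegral hN) hP
  have h3 : aeval (z ^ k) P = 0 := by
    rw [hQ, hz.minpoly_eq_pow_coprime hk, map_mul, minpoly.aeval, zero_mul]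
  simp only [P, map_sub, map_mul, map_add, map_pow, aeval_X, map_one] at h3
  unfold BkEq
  rw [← pow_mul z a k, ← pow_mul z b k, mul_comm a k, mul_comm b k, pow_mul z k a, pow_mul z k b]
  exact sub_eq_zero.1 h3

theorem prim_pow_iff {z : ℂ} {n : ℕ} (hz : IsPrimitiveRoot z n) (hn : 0 < n) (i j : ℕ) :
    z ^ i = z ^ j ↔ i ≡ j [MOD n] := by
  rw [pow_eq_pow_mod i hz.pow_eq_one, pow_eq_pow_mod j hz.pow_eq_one]
  constructor
  · intro h
    exact hz.pow_inj (Nat.mod_lt _ hn) (Nat.mod_lt _ hn) h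
  · intro h
    rw [Nat.ModEq] at h
    rw [h]

theorem core (n m : ℕ) (hn : 5 ≤ n) (hm : 3 ≤ m) (j : ℕ) (hj : 2 ≤ j) (hjn : j + 2 ≤ n)
    (h : BkEq m (Complex.exp (2 * Real.pi * Complex.I / n))
      (Complex.exp (2 * Real.pi * Complex.I / n) ^ j)) :
    1 + Complex.exp (2 * Real.pi * Complex.I / n) ^ m = 0 := by
  have hn0 : (0:ℝ) < n := by exact_mod_cast (by omega : 0 < n)
  have hn5 : (5:ℝ) ≤ n := by exact_mod_cast hn
  set x : ℝ := Real.pi / n with hx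
  have hnx : n * x = Real.pi := by rw [hx]; field_simp
  have hx0 : 0 < x := by rw [hx]; positivity
  have hpw : ∀ k : ℕ, Complex.exp (2 * Real.pi * Complex.I / n) ^ k
      = Complex.exp (2 * ((k * x : ℝ) : ℂ) * Complex.I) := by
    intro k
    rw [← Complex.exp_nat_mul]
    congr 1
    rw [hx]; push_cast; ring
  have hp1 : Complex.exp (2 * Real.pi * Complex.I / n) = Complex.exp (2 * (x : ℂ) * Complex.I) := by
    have := hpw 1
    simpa using this
  have h2 := congrArg norm h
  rw [norm_mul, norm_mul, norm_pow, norm_pow, hpw m, ← pow_mul, hpw j, hpw (j * m), hp1,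
    norm_one_add_exp, norm_one_add_exp, norm_one_sub_exp, norm_one_sub_exp] at h2
  have hsx : 0 < Real.sin x := Real.sin_pos_of_pos_of_lt_pi hx0 (by nlinarith)
  have hcx : 0 < Real.cos x := Real.cos_pos_of_mem_Ioo ⟨by linarith [Real.pi_pos], by nlinarith⟩
  have hj2 : (2:ℝ) ≤ j := by exact_mod_cast hj
  have hjn2 : (j:ℝ) + 2 ≤ n := by exact_mod_cast hjn
  have hsj : Real.sin (2 * x) ≤ |Real.sin (j * x)| :=
    le_trans (sin_ge_aux (by linarith) (by nlinarith) (by nlinarith)) (le_abs_self _)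
  by_contra hne
  have hc : Real.cos (m * x) ≠ 0 := by
    intro hc
    apply hne
    rw [hpw m, ← norm_eq_zero, norm_one_add_exp, hc]; simp
  have key := numeric n m hn hm hc
  rw [← hx] at key
  rw [abs_of_pos hsx] at h2
  have h3 : 2 * |Real.cos (m * x)| * (2 * Real.sin (2 * x)) ^ m ≤ 2 * (2 * Real.sin x) ^ m := by
    calc 2 * |Real.cos (m * x)| * (2 * Real.sin (2 * x)) ^ m
        ≤ 2 * |Real.cos (m * x)| * (2 * |Real.sin (j * x)|) ^ m := by
          have : 0 ≤ Real.sin (2 * x) := by rw [Real.sin_two_mul]; positivity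
          gcongr
      _ = _ := h2.symm
      _ ≤ 2 * 1 * (2 * Real.sin x) ^ m := by
          gcongr
          exact Real.abs_cos_le_one _
      _ = _ := by ring
  rw [Real.sin_two_mul] at h3
  have e : (2 * (2 * Real.sin x * Real.cos x)) ^ m = (2 * Real.sin x) ^ m * (2 * Real.cos x) ^ m := by
    rw [← mul_pow]; ring
  rw [e] at h3
  have hp : 0 < (2 * Real.sin x) ^ m := by positivity
  nlinarith

theorem lemL (m : ℕ) (hm : 3 ≤ m) (n : ℕ) (hn : 5 ≤ n) (μ : ℂ) (hμ : IsPrimitiveRoot μ n) (b : ℕ)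
    (h1 : μ ^ b ≠ 1) (h2 : μ ^ b ≠ μ) (h3 : μ ^ b * μ ≠ 1) (h : BkEq m μ (μ ^ b)) :
    1 + μ ^ m = 0 := by
  have : NeZero n := ⟨by omega⟩
  have hz := Complex.isPrimitiveRoot_exp n (by omega)
  obtain ⟨k, -, hk, hke⟩ := (hμ.isPrimitiveRoot_iff).1 hz
  have hb := h.conj n (by omega) hμ.pow_eq_one (by rw [← pow_mul, mul_comm, pow_mul, hμ.pow_eq_one, one_pow]) k hk
  have e0 : (μ ^ b) ^ k = (μ ^ k) ^ (b % n) := by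
    rw [← pow_mul, mul_comm, pow_mul, hke]
    exact (prim_pow_iff hz (by omega) _ _).2 (Nat.mod_modEq b n).symm
  have e1 : μ ^ b = μ ^ (b % n) := by
    exact (prim_pow_iff hμ (by omega) _ _).2 (Nat.mod_modEq b n).symm
  have hlt := Nat.mod_lt b (by omega : n > 0)
  rw [e0] at hb
  rw [e1] at h1 h2 h3
  set j := b % n
  have j0 : j ≠ 0 := by rintro h; apply h1; rw [h, pow_zero]
  have j1 : j ≠ 1 := by rintro h; apply h2; rw [h, pow_one]
  have j2 : j ≠ n - 1 := by
    rintro h; apply h3; rw [← pow_succ, h, Nat.sub_add_cancel (by omega), hμ.pow_eq_one]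
  rw [hke] at hb
  have hc := core n m hn hm j (by omega) (by omega) hb
  -- transport back
  obtain ⟨l, -, hl, hle⟩ := (hz.isPrimitiveRoot_iff).1 hμ
  let P : ℤ[X] := 1 + X ^ m
  have hP : aeval (Complex.exp (2 * Real.pi * Complex.I / n)) P = 0 := by
    simpa [P] using hc
  obtain ⟨Q, hQ⟩ := minpoly.isIntegrallyClosed_dvd (hz.isIntegral (by omega)) hP
  have h3 : aeval μ P = 0 := by
    rw [hQ, hz.minpoly_eq_pow_coprime hl, hle, map_mul, minpoly.aeval, zero_mul]
  simpa [P] using h3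

theorem coprime_aux (n p t : ℕ) (hp : p.Prime) (hpn : p ∣ n) (h : ¬ p ∣ 1 + t * (n / p)) :
    (1 + t * (n / p)).Coprime n := by
  apply Nat.Coprime.symm
  apply Nat.coprime_of_dvd
  intro q hq hqn hqa
  obtain ⟨d, rfl⟩ := hpn
  rw [Nat.mul_div_cancel_left _ hp.pos] at *
  by_cases hqp : q = p
  · subst hqp; exact h hqa
  · have : q ∣ d := by
      rcases hq.dvd_mul.1 hqn with h' | h'
      · exact absurd ((Nat.prime_dvd_prime_iff_eq hq hp).1 h') hqp
      · exact h'
    have h1 : q ∣ 1 := (Nat.dvd_add_left (Dvd.dvd.mul_left this t)).1 hqa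
    exact hq.one_lt.ne' (Nat.dvd_one.1 h1)

theorem exists_unit (n : ℕ) (hn : 5 ≤ n) (h6 : n ≠ 6) :
    ∃ a, 2 ≤ a ∧ a + 2 ≤ n ∧ a.Coprime n := by
  have h4 : n % 4 = 0 ∨ n % 4 = 2 ∨ n % 2 = 1 := by omega
  rcases h4 with h | h | h
  · obtain ⟨k, rfl⟩ : ∃ k, n = 4 * k := ⟨n / 4, by omega⟩
    refine ⟨2 * k + 1, by omega, by omega, ?_⟩
    apply Nat.Coprime.mul_right
    · exact (Nat.coprime_pow_right_iff (n := 2) (by norm_num) _ 2).2 (by simp)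
    · simp
  · obtain ⟨k, rfl⟩ : ∃ k, n = 4 * k + 10 := ⟨n / 4 - 2, by omega⟩
    refine ⟨2 * k + 3, by omega, by omega, ?_⟩
    have : 4 * k + 10 = 4 + (2 * k + 3) * 2 := by ring
    rw [this, Nat.coprime_add_mul_left_right]
    exact (Nat.coprime_pow_right_iff (n := 2) (by norm_num) _ 2).2 (by rw [Nat.coprime_two_right]; exact Nat.odd_iff.2 (by omega))
  · refine ⟨2, le_rfl, by omega, ?_⟩
    rw [Nat.coprime_two_left]
    exact Nat.odd_iff.2 h

theorem arith (n g : ℕ) (hn : 5 ≤ n) (h6 : n ≠ 6) (hg : g ∣ n)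
    (H : ∀ a : ℕ, a.Coprime n → g ∣ a - 1 → 1 ≤ a → (n ∣ a - 1 ∨ n ∣ a + 1)) :
    n = g ∨ (n = 2 * g ∧ g % 2 = 1) := by
  have g0 : g ≠ 0 := by rintro rfl; simp at hg; omega
  have hg2 : 3 ≤ g := by
    by_contra hlt
    obtain ⟨a, ha, han, hc⟩ := exists_unit n hn h6
    have : g ∣ a - 1 := by
      have : g = 1 ∨ g = 2 := by omega
      rcases this with rfl | rfl
      · simp
      · have h2 : Nat.Coprime a 2 := hc.coprime_dvd_right hg
        have := Nat.odd_iff.1 (Nat.coprime_two_right.1 h2)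
        omega
    rcases H a hc this (by omega) with h | h
    · have := Nat.le_of_dvd (by omega) h; omega
    · have := Nat.le_of_dvd (by omega) h; omega
  have H' : ∀ c : ℕ, (1 + c).Coprime n → g ∣ c → n ∣ c := by
    intro c hc hgc
    rcases H (1 + c) hc (by simpa using hgc) (by omega) with h | h
    · simpa using h
    · exfalso
      have h1 : g ∣ 1 + c + 1 := hg.trans h
      have h2 : 1 + c + 1 = 2 + c := by ring
      rw [h2, Nat.dvd_add_left hgc] at h1
      have := Nat.le_of_dvd (by norm_num) h1
      omega
  obtain ⟨d, rfl⟩ := hg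
  have d0 : d ≠ 0 := by rintro rfl; simp at hn
  have main : ∀ p t, p.Prime → p ∣ d → ¬ p ∣ 1 + t * (g * d / p) → p ∣ t := by
    intro p t hp hpd ht
    have h1 := coprime_aux (g * d) p t hp (Dvd.dvd.mul_left hpd g) ht
    obtain ⟨e, rfl⟩ := hpd
    have e1 : g * (p * e) / p = g * e := by
      rw [show g * (p * e) = p * (g * e) by ring, Nat.mul_div_cancel_left _ hp.pos]
    rw [e1] at h1
    have h2 := H' _ h1 ⟨t * e, by ring⟩
    have e0 : 0 < g * e := by
      rcases Nat.eq_zero_or_pos e with rfl | h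
      · simp at d0
      · positivity
    rw [show g * (p * e) = p * (g * e) by ring] at h2
    exact Nat.dvd_of_mul_dvd_mul_right e0 h2
  have podd : ∀ p, p.Prime → p ∣ d → p = 2 := by
    intro p hp hpd
    by_contra hne
    have hp3 : 3 ≤ p := by have := hp.two_le; omega
    have h1 : p ∣ 1 + 1 * (g * d / p) := by
      by_contra hh
      have := Nat.le_of_dvd (by norm_num) (main p 1 hp hpd hh)
      omega
    have h2 : p ∣ 1 + 2 * (g * d / p) := by
      by_contra hh
      have := Nat.le_of_dvd (by norm_num) (main p 2 hp hpd hh)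
      omega
    set w := g * d / p
    have h3 : 1 + 2 * w = w + (1 + 1 * w) := by ring
    rw [h3, Nat.dvd_add_left h1] at h2
    rw [one_mul, Nat.dvd_add_left h2] at h1
    have := Nat.le_of_dvd (by norm_num) h1
    omega
  have h4 : 2 ∣ d → ¬ 4 ∣ g * d := by
    intro h2 hh
    have := main 2 1 Nat.prime_two h2 (by omega)
    omega
  by_cases hd1 : d = 1
  · left; simp [hd1]
  right
  have h2d : 2 ∣ d := by
    have := podd _ (Nat.minFac_prime hd1) (Nat.minFac_dvd d)
    rw [← this]; exact Nat.minFac_dvd d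
  have hd := h4 h2d
  obtain ⟨e, rfl⟩ := h2d
  have he1 : e = 1 := by
    by_contra he
    have := podd _ (Nat.minFac_prime he) ((Nat.minFac_dvd e).trans (Dvd.intro_left 2 rfl))
    have h2e : 2 ∣ e := by rw [← this]; exact Nat.minFac_dvd e
    obtain ⟨f, rfl⟩ := h2e
    exact hd ⟨g * f, by ring⟩
  subst he1
  refine ⟨by ring, ?_⟩
  by_contra hgo
  apply hd
  omega
theorem norm_sq_aux {w v : ℂ} {c : ℝ} (hc : 0 ≤ c) (hv : ‖v‖ = 1) (h : w ^ 2 = c * v ∨ w ^ 2 = -(c * v)) :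
    ‖w‖ ^ 2 = c := by
  rw [← norm_pow]
  rcases h with h | h
  · rw [h, norm_mul, hv, mul_one, Complex.norm_real, Real.norm_eq_abs, abs_of_nonneg hc]
  · rw [h, norm_neg, norm_mul, hv, mul_one, Complex.norm_real, Real.norm_eq_abs, abs_of_nonneg hc]

theorem bk_small (n m : ℕ) (hn : n = 2 ∨ n = 3 ∨ n = 4 ∨ n = 6) (μ : ℂ) (hμ : IsPrimitiveRoot μ n)
    (h0 : 1 + μ ^ m ≠ 0) :
    (n = 2 ∧ ‖1 - μ‖ ^ 2 = 4 ∧ ‖1 + μ ^ m‖ ^ 2 = 4) ∨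
    (n = 3 ∧ ‖1 - μ‖ ^ 2 = 3 ∧ (‖1 + μ ^ m‖ ^ 2 = 1 ∨ ‖1 + μ ^ m‖ ^ 2 = 4)) ∨
    (n = 4 ∧ ‖1 - μ‖ ^ 2 = 2 ∧ (‖1 + μ ^ m‖ ^ 2 = 2 ∨ ‖1 + μ ^ m‖ ^ 2 = 4)) ∨
    (n = 6 ∧ ‖1 - μ‖ ^ 2 = 1 ∧
      (‖1 + μ ^ m‖ ^ 2 = 1 ∨ ‖1 + μ ^ m‖ ^ 2 = 3 ∨ ‖1 + μ ^ m‖ ^ 2 = 4)) := by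
  have hw : (μ ^ m) ^ n = 1 := by rw [← pow_mul, mul_comm, pow_mul, hμ.pow_eq_one, one_pow]
  have hn0 : n ≠ 0 := by omega
  have nμ : ‖μ‖ = 1 := hμ.norm'_eq_one hn0
  have nw : ‖μ ^ m‖ = 1 := by rw [norm_pow, nμ, one_pow]
  have hpr : ∀ k, 0 < k → k < n → μ ^ k ≠ 1 := fun k hk hkn => hμ.pow_ne_one_of_pos_of_lt hk.ne' hkn
  have hone := hμ.pow_eq_one
  set w := μ ^ m
  have w1 : w = 1 → ‖1 + w‖ ^ 2 = 4 := by rintro h; rw [h]; norm_num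
  have n1 : ‖(1:ℂ)‖ = 1 := norm_one
  rcases hn with rfl | rfl | rfl | rfl
  · left
    have h1 := hpr 1 (by norm_num) (by norm_num)
    have e : (μ - 1) * (μ + 1) = 0 := by linear_combination hone
    have e2 : (w - 1) * (1 + w) = 0 := by linear_combination hw
    rcases mul_eq_zero.1 e with h | h
    · exact absurd (by linear_combination h) h1
    refine ⟨rfl, ?_, w1 ?_⟩
    · rw [eq_neg_of_add_eq_zero_left h]; norm_num
    · rcases mul_eq_zero.1 e2 with h' | h'
      · linear_combination h'
      · exact absurd h' h0
  · right; left
    have h1 := hpr 1 (by norm_num) (by norm_num)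
    have e : (μ - 1) * (μ ^ 2 + μ + 1) = 0 := by linear_combination hone
    have e2 : (w - 1) * (w ^ 2 + w + 1) = 0 := by linear_combination hw
    rcases mul_eq_zero.1 e with h | h
    · exact absurd (by linear_combination h) h1
    refine ⟨rfl, norm_sq_aux (v := μ) (by norm_num) nμ (Or.inr ?_), ?_⟩
    · push_cast; linear_combination h
    · rcases mul_eq_zero.1 e2 with h' | h'
      · right; exact w1 (by linear_combination h')
      · left; exact norm_sq_aux (v := w) (by norm_num) nw (Or.inl (by push_cast; linear_combination h'))
  · right; right; left
    have h1 := hpr 2 (by norm_num) (by norm_num)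
    have e : (μ ^ 2 - 1) * (μ ^ 2 + 1) = 0 := by linear_combination hone
    have e2 : (w - 1) * ((1 + w) * (w ^ 2 + 1)) = 0 := by linear_combination hw
    rcases mul_eq_zero.1 e with h | h
    · exact absurd (by linear_combination h) h1
    refine ⟨rfl, norm_sq_aux (v := μ) (by norm_num) nμ (Or.inr ?_), ?_⟩
    · push_cast; linear_combination h
    · rcases mul_eq_zero.1 e2 with h' | h'
      · right; exact w1 (by linear_combination h')
      · rcases mul_eq_zero.1 h' with h' | h'
        · exact absurd h' h0
        left; exact norm_sq_aux (v := w) (by norm_num) nw (Or.inl (by push_cast; linear_combination h'))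
  · right; right; right
    have h1 := hpr 3 (by norm_num) (by norm_num)
    have h2 := hpr 2 (by norm_num) (by norm_num)
    have e : (μ ^ 3 - 1) * ((μ + 1) * (μ ^ 2 - μ + 1)) = 0 := by linear_combination hone
    have e2 : (w - 1) * ((1 + w) * ((w ^ 2 + w + 1) * (w ^ 2 - w + 1))) = 0 := by
      linear_combination hw
    have h : μ ^ 2 - μ + 1 = 0 := by
      rcases mul_eq_zero.1 e with h | h
      · exact absurd (by linear_combination h) h1
      rcases mul_eq_zero.1 h with h | h
      · exact absurd (by linear_combination (μ - 1) * h) h2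
      exact h
    refine ⟨rfl, norm_sq_aux (v := μ) (by norm_num) nμ (Or.inr ?_), ?_⟩
    · push_cast; linear_combination h
    · rcases mul_eq_zero.1 e2 with h' | h'
      · right; right; exact w1 (by linear_combination h')
      rcases mul_eq_zero.1 h' with h' | h'
      · exact absurd h' h0
      rcases mul_eq_zero.1 h' with h' | h'
      · left; exact norm_sq_aux (v := w) (by norm_num) nw (Or.inl (by push_cast; linear_combination h'))
      · right; left
        exact norm_sq_aux (v := w) (by norm_num) nw (Or.inl (by push_cast; linear_combination h'))

theorem four_three (m : ℕ) (hm : 3 ≤ m) : (4:ℝ) ^ m ≠ 4 * 3 ^ m := by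
  intro h
  have h' : 4 ^ m = 4 * 3 ^ m := by exact_mod_cast h
  obtain ⟨k, rfl⟩ : ∃ k, m = k + 2 := ⟨m - 2, by omega⟩
  have h2 : 4 * 4 ^ k = 3 ^ (k + 2) := by
    have : 4 ^ (k + 2) = 4 * (4 * 4 ^ k) := by ring
    omega
  have : Odd (3 ^ (k + 2)) := Odd.pow (by decide)
  rw [← h2, Nat.odd_iff] at this
  omega

theorem bk_small_pair (n n' m : ℕ) (hm : 3 ≤ m) (hn : n = 2 ∨ n = 3 ∨ n = 4 ∨ n = 6)
    (hn' : n' = 2 ∨ n' = 3 ∨ n' = 4 ∨ n' = 6) (hlt : n < n') (μ ν : ℂ) (hμ : IsPrimitiveRoot μ n)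
    (hν : IsPrimitiveRoot ν n') (h0 : 1 + μ ^ m ≠ 0) (h0' : 1 + ν ^ m ≠ 0) (h : BkEq m μ ν) :
    False := by
  have h2 := congrArg (fun z => ‖z‖ ^ 2) h
  simp only [norm_mul, norm_pow, mul_pow] at h2
  rw [← pow_mul, ← pow_mul, mul_comm m 2, pow_mul, pow_mul] at h2
  have e2 : (8:ℝ) ≤ 2 ^ m := by
    calc (8:ℝ) = 2 ^ 3 := by norm_num
      _ ≤ _ := pow_le_pow_right₀ (by norm_num) hm
  have e3 : (27:ℝ) ≤ 3 ^ m := by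
    calc (27:ℝ) = 3 ^ 3 := by norm_num
      _ ≤ _ := pow_le_pow_right₀ (by norm_num) hm
  have e4 : (4:ℝ) ^ m = 2 ^ m * 2 ^ m := by rw [← mul_pow]; norm_num
  have e43 : (3:ℝ) ^ m < 4 ^ m := pow_lt_pow_left₀ (by norm_num) (by norm_num) (by omega)
  have e32 : (27/8) * (2:ℝ) ^ m ≤ 3 ^ m := by
    have : (3:ℝ) ^ m = (3/2) ^ m * 2 ^ m := by rw [← mul_pow]; norm_num
    rw [this]
    gcongr
    calc (27/8:ℝ) = (3/2) ^ 3 := by norm_num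
      _ ≤ _ := pow_le_pow_right₀ (by norm_num) hm
  have e5 := four_three m hm
  have s1 := bk_small n m hn μ hμ h0
  have s2 := bk_small n' m hn' ν hν h0'
  rcases s1 with ⟨a, b, c⟩ | ⟨a, b, c⟩ | ⟨a, b, c⟩ | ⟨a, b, c⟩ <;>
  rcases s2 with ⟨a', b', c'⟩ | ⟨a', b', c'⟩ | ⟨a', b', c'⟩ | ⟨a', b', c'⟩ <;>
  first
  | (exfalso; omega)
  | skip
  all_goals rw [b, b'] at h2
  · rcases c' with c' | c' <;> rw [c, c'] at h2
    · exact e5 (by linarith)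
    · linarith
  · rcases c' with c' | c' <;> rw [c, c'] at h2 <;> nlinarith
  · rcases c' with c' | c' | c' <;> rw [c, c'] at h2 <;> simp only [one_pow] at h2 <;> nlinarith
  · rcases c with c | c <;> rcases c' with c' | c' <;> rw [c, c'] at h2 <;> linarith
  · rcases c with c | c <;> rcases c' with c' | c' | c' <;> rw [c, c'] at h2 <;>
      simp only [one_pow] at h2 <;> linarith
  · rcases c with c | c <;> rcases c' with c' | c' | c' <;> rw [c, c'] at h2 <;>
      simp only [one_pow] at h2 <;> linarith

theorem bk_small_same (n : ℕ) (hn : n = 2 ∨ n = 3 ∨ n = 4 ∨ n = 6) (μ ν : ℂ)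
    (hμ : IsPrimitiveRoot μ n) (hν : IsPrimitiveRoot ν n) (hne : μ ≠ ν) (hinv : μ * ν ≠ 1) :
    False := by
  have : NeZero n := ⟨by omega⟩
  obtain ⟨i, hi, hc, rfl⟩ := (hμ.isPrimitiveRoot_iff).1 hν
  have h1 : i ≠ 1 := by rintro rfl; simp at hne
  have h2 : i + 1 ≠ n := by
    intro h; apply hinv; rw [← pow_succ', h, hμ.pow_eq_one]
  rcases hn with rfl | rfl | rfl | rfl <;> interval_cases i <;> simp_all <;> revert hc <;> decide

/-- If `μ` has large order, then the automorphisms fixing `ν` severely restrict the order. -/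
theorem order_restrict (n n' m : ℕ) (hm : 3 ≤ m) (hn : 5 ≤ n) (h6 : n ≠ 6) (hn' : 2 ≤ n')
    (μ ν : ℂ) (hμ : IsPrimitiveRoot μ n) (hν : IsPrimitiveRoot ν n') (h0 : 1 + μ ^ m ≠ 0)
    (h : BkEq m μ ν) : n = n.gcd n' ∨ (n = 2 * n.gcd n' ∧ n.gcd n' % 2 = 1) := by
  apply arith n _ hn h6 (Nat.gcd_dvd_left n n')
  intro a hac hga ha
  have hmod : a ≡ 1 [MOD n.gcd n'] := ((Nat.modEq_iff_dvd' ha).2 hga).symm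
  obtain ⟨k, hk1, hk2⟩ := Nat.chineseRemainder' hmod
  have hkn : k.Coprime n := by
    rw [Nat.Coprime, hk1.gcd_eq]; exact hac
  have hkn' : k.Coprime n' := by
    rw [Nat.Coprime, hk2.gcd_eq]; simp
  have hc := h.conj (n * n') (by positivity) (by rw [pow_mul, hμ.pow_eq_one, one_pow])
    (by rw [mul_comm, pow_mul, hν.pow_eq_one, one_pow]) k (Nat.Coprime.mul_right hkn hkn')
  have ea : μ ^ k = μ ^ a := by
    exact (prim_pow_iff hμ (by omega) _ _).2 hk1
  have eν : ν ^ k = ν := by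
    conv_rhs => rw [← pow_one ν]
    exact (prim_pow_iff hν (by omega) _ _).2 hk2
  rw [ea, eν] at hc
  have hν1 : 1 - ν ≠ 0 := by
    intro h'
    have := hν.ne_one (by omega)
    exact this (by linear_combination -h')
  have hb : BkEq m μ (μ ^ a) := by
    unfold BkEq at *
    have hp : (1 - ν) ^ m ≠ 0 := pow_ne_zero _ hν1
    apply mul_right_cancel₀ hp
    linear_combination (1 - μ ^ a) ^ m * h - (1 - μ) ^ m * hc
  by_contra hcon
  push Not at hcon
  apply h0
  apply lemL m hm n hn μ hμ a _ _ _ hb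
  · intro h1
    have := (hμ.pow_eq_one_iff_dvd a).1 h1
    have h2 := Nat.Coprime.eq_one_of_dvd hac.symm this
    omega
  · intro h1
    apply hcon.1
    conv_rhs at h1 => rw [← pow_one μ]
    rw [prim_pow_iff hμ (by omega)] at h1
    exact (Nat.modEq_iff_dvd' ha).1 h1.symm
  · intro h1
    apply hcon.2
    rw [← pow_succ] at h1
    exact (hμ.pow_eq_one_iff_dvd _).1 h1

/-- Case where the order of `ν` divides the order of `μ`. -/
theorem dvd_case (n n' m : ℕ) (hm : 3 ≤ m) (hn : 5 ≤ n) (hn' : 2 ≤ n') (hd : n' ∣ n)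
    (μ ν : ℂ) (hμ : IsPrimitiveRoot μ n) (hν : IsPrimitiveRoot ν n') (h0 : 1 + μ ^ m ≠ 0)
    (hne : μ ≠ ν) (hinv : μ * ν ≠ 1) (h : BkEq m μ ν) : False := by
  have : NeZero n := ⟨by omega⟩
  have h1 : ν ^ n = 1 := (hν.pow_eq_one_iff_dvd n).2 hd
  obtain ⟨b, -, rfl⟩ := hμ.eq_pow_of_pow_eq_one h1
  exact h0 (lemL m hm n hn μ hμ b (hν.ne_one (by omega)) hne.symm
    (by rwa [mul_comm]) h)

theorem big_case (n n' m : ℕ) (hm : 3 ≤ m) (hn : 5 ≤ n) (h6 : n ≠ 6) (hn' : 2 ≤ n')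
    (μ ν : ℂ) (hμ : IsPrimitiveRoot μ n) (hν : IsPrimitiveRoot ν n') (h0 : 1 + μ ^ m ≠ 0)
    (h0' : 1 + ν ^ m ≠ 0)
    (hne : μ ≠ ν) (hinv : μ * ν ≠ 1) (h : BkEq m μ ν) : False := by
  have hinv' : ν * μ ≠ 1 := by rwa [mul_comm]
  rcases order_restrict n n' m hm hn h6 hn' μ ν hμ hν h0 h with h1 | ⟨h1, h2⟩
  · have hd : n ∣ n' := by rw [h1]; exact Nat.gcd_dvd_right n n'
    have := Nat.le_of_dvd (by omega) hd
    exact dvd_case n' n m hm (by omega) (by omega) hd ν μ hν hμ h0' hne.symm hinv' h.symm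
  · have hgd := Nat.gcd_dvd_right n n'
    by_cases hb : 5 ≤ n' ∧ n' ≠ 6
    · rcases order_restrict n' n m hm hb.1 hb.2 (by omega) ν μ hν hμ h0' h.symm with h3 | ⟨h3, h4⟩
      · have hd : n' ∣ n := by rw [h3]; exact Nat.gcd_dvd_right n' n
        exact dvd_case n n' m hm hn hn' hd μ ν hμ hν h0 hne hinv h
      · rw [Nat.gcd_comm] at h3
        have : n = n' := by omega
        rw [← this, Nat.gcd_self] at h1
        omega
    · have hn6 : n' ≤ 6 := by omega
      have hle := Nat.le_of_dvd (by omega) hgd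
      generalize n.gcd n' = g at *
      have : g = 3 ∨ g = 5 := by omega
      rcases this with rfl | rfl
      · omega
      · omega

theorem main_aux (m : ℕ) (hm : 3 ≤ m) (μ ν : ℂ) (n n' : ℕ) (hn : 2 ≤ n) (hn' : 2 ≤ n')
    (hμ : IsPrimitiveRoot μ n) (hν : IsPrimitiveRoot ν n') (h0 : 1 + μ ^ m ≠ 0)
    (h0' : 1 + ν ^ m ≠ 0)
    (hne : μ ≠ ν) (hinv : μ * ν ≠ 1) (h : BkEq m μ ν) : False := by
  have hinv' : ν * μ ≠ 1 := by rwa [mul_comm]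
  by_cases hb : 5 ≤ n ∧ n ≠ 6
  · exact big_case n n' m hm hb.1 hb.2 hn' μ ν hμ hν h0 h0' hne hinv h
  by_cases hb' : 5 ≤ n' ∧ n' ≠ 6
  · exact big_case n' n m hm hb'.1 hb'.2 hn ν μ hν hμ h0' h0 hne.symm hinv' h.symm
  have c1 : n = 2 ∨ n = 3 ∨ n = 4 ∨ n = 6 := by omega
  have c2 : n' = 2 ∨ n' = 3 ∨ n' = 4 ∨ n' = 6 := by omega
  rcases lt_trichotomy n n' with hlt | heq | hlt
  · exact bk_small_pair n n' m hm c1 c2 hlt μ ν hμ hν h0 h0' h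
  · subst heq
    exact bk_small_same n c1 μ ν hμ hν hne hinv
  · exact bk_small_pair n' n m hm c2 c1 hlt ν μ hν hμ h0' h0 h.symm

theorem beukers_diophantine_two (m : ℕ) (hm : 1 < m) (μ ν : ℂ)
    (hμ : IsRootOfUnity μ) (hν : IsRootOfUnity ν)
    (hne : μ ≠ ν) (hnotboth : ¬(μ = 1 ∧ ν = 1))
    (heven : Even m → ν ≠ μ⁻¹)
    (heq : (1 + ν ^ m) * (1 - μ) ^ m = (1 + μ ^ m) * (1 - ν) ^ m) :
    μ ^ m = -1 ∧ ν ^ m = -1 := by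
  have hm0 : m ≠ 0 := by omega
  have hμ1 : μ ≠ 1 := by
    rintro rfl
    have h1 : (1 - ν) ^ m = 0 := by
      rw [sub_self, zero_pow hm0, mul_zero, one_pow] at heq
      exact (mul_eq_zero.1 heq.symm).resolve_left (by norm_num)
    exact hne (sub_eq_zero.1 (pow_eq_zero_iff hm0 |>.1 h1))
  have hν1 : ν ≠ 1 := by
    rintro rfl
    have h1 : (1 - μ) ^ m = 0 := by
      rw [sub_self, zero_pow hm0, mul_zero, one_pow] at heq
      exact (mul_eq_zero.1 heq).resolve_left (by norm_num)
    exact hne (sub_eq_zero.1 (pow_eq_zero_iff hm0 |>.1 h1)).symm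
  have pμ : (1 - μ) ^ m ≠ 0 := pow_ne_zero _ (sub_ne_zero.2 hμ1.symm)
  have pν : (1 - ν) ^ m ≠ 0 := pow_ne_zero _ (sub_ne_zero.2 hν1.symm)
  have iff0 : 1 + μ ^ m = 0 ↔ 1 + ν ^ m = 0 := by
    constructor
    · intro h
      rw [h, zero_mul] at heq
      exact (mul_eq_zero.1 heq).resolve_right pμ
    · intro h
      rw [h, zero_mul] at heq
      exact (mul_eq_zero.1 heq.symm).resolve_right pν
  by_cases h0 : 1 + μ ^ m = 0
  · exact ⟨by linear_combination h0, by linear_combination iff0.1 h0⟩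
  exfalso
  have h0' : 1 + ν ^ m ≠ 0 := fun h => h0 (iff0.2 h)
  have hμ0 : μ ≠ 0 := by
    rintro rfl
    obtain ⟨k, hk, hk'⟩ := hμ
    rw [zero_pow hk.ne'] at hk'
    exact zero_ne_one hk'
  have hinv : μ * ν ≠ 1 := by
    intro hi
    have hνe : ν = μ⁻¹ := eq_inv_of_mul_eq_one_right hi
    rcases Nat.even_or_odd m with he | ho
    · exact heven he hνe
    · have hwm : μ ^ m * ν ^ m = 1 := by rw [← mul_pow, hi, one_pow]
      have e1 : (1 - μ) ^ m = - (μ ^ m * (1 - ν) ^ m) := by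
        rw [← mul_pow, ← ho.neg_pow]
        congr 1
        linear_combination -hi
      rw [e1] at heq
      have : (1 + μ ^ m) * (1 - ν) ^ m = 0 := by
        linear_combination (-1/2) * heq - (1/2) * (1 - ν) ^ m * hwm
      rcases mul_eq_zero.1 this with h | h
      · exact h0 h
      · exact pν h
  by_cases hm2 : m = 2
  · subst hm2
    have : (μ - ν) * (1 - μ * ν) = 0 := by linear_combination (-1/2) * heq
    rcases mul_eq_zero.1 this with h | h
    · exact hne (sub_eq_zero.1 h)
    · exact hinv (sub_eq_zero.1 h).symm
  have ord : ∀ z : ℂ, IsRootOfUnity z → z ≠ 1 → 2 ≤ orderOf z := by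
    rintro z ⟨k, hk, hk'⟩ hz
    have h1 : 0 < orderOf z := orderOf_pos_iff.2 (isOfFinOrder_iff_pow_eq_one.2 ⟨k, hk, hk'⟩)
    have h2 : orderOf z ≠ 1 := fun h => hz (orderOf_eq_one_iff.1 h)
    omega
  exact main_aux m (by omega) μ ν (orderOf μ) (orderOf ν) (ord μ hμ hμ1) (ord ν hν hν1)
    (IsPrimitiveRoot.orderOf μ) (IsPrimitiveRoot.orderOf ν) h0 h0' hne hinv heq
end

section
/- (Skolem–Mahler–Lech) Let U : ℕ → ℂ be a sequence satisfying a linear recurrence relation, i.e., there exist n ≥ 1 and constants s₁, …, sₙ ∈ ℂ such that U(m+n) = s₁·U(m+n-1) + ⋯ + sₙ·U(m) for all m ∈ ℕ. Then the zero set {m ∈ ℕ : U(m) = 0} is the union of a finite set and finitely many complete arithmetic progressions, i.e., there exist a finite set F ⊆ ℕ and finitely many pairs (f₁,g₁), …, (f_k,g_k) with gᵢ ≥ 1 such that {m ∈ ℕ : U(m) = 0} = F ∪ ⋃ᵢ {fᵢ + gᵢ·h : h ∈ ℕ}. -/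
lemma sml_isUnit_natCast (p : ℕ) [hp : Fact p.Prime] (k : ℕ) (hk : ¬ p ∣ k) :
    IsUnit (k : ℤ_[p]) := by
  rw [PadicInt.isUnit_iff]
  refine le_antisymm (PadicInt.norm_le_one _) (not_lt.1 fun h => hk ?_)
  have := (PadicInt.norm_int_lt_one_iff_dvd (p := p) (k : ℤ)).1 (by simpa using h)
  exact_mod_cast this

open Polynomial in
lemma sml_fact_div (p : ℕ) [hp : Fact p.Prime] (hp2 : p ≠ 2) (e j : ℕ) (h : 2 * e ≤ j) :
    ∃ c : ℤ_[p], (p : ℤ_[p]) ^ j = p ^ e * (j.factorial : ℤ_[p]) * c := by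
  have h3 : 2 ≤ p - 1 := by have := hp.out.two_le; omega
  have hv : 2 * padicValNat p j.factorial ≤ j := by
    have h1 := sub_one_mul_padicValNat_factorial (p := p) j
    have : 2 * padicValNat p j.factorial ≤ (p - 1) * padicValNat p j.factorial :=
      Nat.mul_le_mul_right _ h3
    omega
  obtain ⟨v, k, hk, hk2⟩ := Nat.exists_eq_pow_mul_and_not_dvd (Nat.factorial_ne_zero j) p
    hp.out.ne_one
  have hvv : padicValNat p j.factorial = v := by
    have hk0 : k ≠ 0 := by rintro rfl; simp at hk
    rw [hk2, padicValNat.mul (pow_ne_zero _ hp.out.ne_zero) hk0, padicValNat.prime_pow,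
      padicValNat.eq_zero_of_not_dvd hk, add_zero]
  obtain ⟨u, hu⟩ := sml_isUnit_natCast p k hk
  refine ⟨p ^ (j - e - v) * (↑u⁻¹ : ℤ_[p]), ?_⟩
  rw [hk2]
  push_cast
  rw [← hu]
  have : (p : ℤ_[p]) ^ j = p ^ e * p ^ v * p ^ (j - e - v) := by
    rw [← pow_add, ← pow_add]; congr 1; omega
  rw [this]
  calc _ = (p : ℤ_[p]) ^ e * p ^ v * p ^ (j - e - v) * (u * (↑u⁻¹ : ℤ_[p])) := by simp
    _ = _ := by ring

open Polynomial in
lemma sml_hansel (p : ℕ) [hp : Fact p.Prime] (hp2 : p ≠ 2) (b f : ℕ → ℤ_[p])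
    (hf : ∀ x, f x = ∑ j ∈ Finset.range (x + 1), (x.choose j : ℤ_[p]) * p ^ j * b j)
    (hinf : {x | f x = 0}.Infinite) (x : ℕ) : f x = 0 := by
  have h0 : ∀ j, ∃ c : ℤ_[p], (p : ℤ_[p]) ^ j = (j.factorial : ℤ_[p]) * c := fun j => by
    simpa using sml_fact_div p hp2 0 j (by simp)
  choose c hc using h0
  have hcd : ∀ e j, 2 * e ≤ j → (p : ℤ_[p]) ^ e ∣ c j := fun e j h => by
    obtain ⟨d, hd⟩ := sml_fact_div p hp2 e j h
    refine ⟨d, mul_left_cancel₀ (Nat.cast_ne_zero.2 (Nat.factorial_ne_zero j)) ?_⟩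
    rw [← hc, hd]; ring
  -- truncated polynomials
  let P : ℕ → ℤ_[p][X] := fun n =>
    ∑ j ∈ Finset.range (n + 1), (c j * b j) • descPochhammer ℤ_[p] j
  have hP : ∀ n y, y ≤ n → (P n).eval (y : ℤ_[p]) = f y := fun n y hy => by
    rw [hf]
    simp only [P, eval_finsetSum, eval_smul, descPochhammer_eval_eq_descFactorial]
    rw [← Finset.sum_subset (Finset.range_mono (Nat.succ_le_succ hy))]
    · refine Finset.sum_congr rfl fun j _ => ?_
      rw [Nat.descFactorial_eq_factorial_mul_choose, hc]
      push_cast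
      simp only [smul_eq_mul]; ring
    · intro j _ hj
      rw [Nat.descFactorial_eq_zero_iff_lt.2 (by simpa using hj)]
      simp
  have key : ∀ e, (p : ℤ_[p]) ^ e ∣ f x := fun e => by
    obtain ⟨t, ht, htc⟩ := hinf.exists_subset_card_eq (2 * e)
    let n := x + t.sup id
    have htn : ∀ y ∈ t, y ≤ n := fun y hy => by
      have := Finset.le_sup (f := id) hy
      simp only [id] at this; omega
    let D : ℤ_[p][X] := ∏ y ∈ t, (X - C (y : ℤ_[p]))
    have hD : D.Monic := monic_prod_of_monic _ _ fun y _ => monic_X_sub_C _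
    have hDdeg : D.natDegree = 2 * e := by
      rw [natDegree_prod_of_monic _ _ fun y _ => monic_X_sub_C _]; simp [-map_natCast, htc]
    have hdvd : D ∣ P n := by
      by_cases hP0 : P n = 0
      · rw [hP0]; exact dvd_zero _
      have := (Multiset.prod_X_sub_C_dvd_iff_le_roots hP0
        (t.val.map (fun y : ℕ => (y : ℤ_[p])))).2 ?_
      · rw [Multiset.map_map] at this
        exact this
      · rw [Multiset.le_iff_subset (Multiset.Nodup.map Nat.cast_injective t.nodup)]
        intro z hz
        obtain ⟨y, hy, rfl⟩ := Multiset.mem_map.1 hz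
        rw [mem_roots hP0, IsRoot, hP n y (htn y hy)]
        exact ht hy
    have h1 : P n = D * ∑ j ∈ Finset.range (n + 1),
        (c j * b j) • (descPochhammer ℤ_[p] j /ₘ D) := by
      have h2 : P n %ₘ D = ∑ j ∈ Finset.range (n + 1),
          (c j * b j) • (descPochhammer ℤ_[p] j %ₘ D) := by
        change modByMonicHom D (P n) = _
        rw [show P n = ∑ j ∈ Finset.range (n + 1), (c j * b j) • descPochhammer ℤ_[p] j from rfl,
          map_sum]
        exact Finset.sum_congr rfl fun j _ => map_smul _ _ _
      rw [(modByMonic_eq_zero_iff_dvd hD).2 hdvd] at h2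
      rw [Finset.mul_sum, ← zero_add (Finset.sum _ _), h2, ← Finset.sum_add_distrib]
      refine Finset.sum_congr rfl fun j _ => ?_
      rw [mul_smul_comm, ← smul_add, modByMonic_add_div]
    rw [← hP n x (by omega), h1, eval_mul, eval_finsetSum]
    refine Dvd.dvd.mul_left (Finset.dvd_sum fun j _ => ?_) _
    rw [eval_smul, smul_eq_mul]
    by_cases hj : 2 * e ≤ j
    · exact Dvd.dvd.mul_right (Dvd.dvd.mul_right (hcd e j hj) _) _
    · rw [(divByMonic_eq_zero_iff hD).2]
      · simp
      · apply degree_lt_degree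
        rw [hDdeg, descPochhammer_natDegree]; omega
  by_contra hne
  obtain ⟨e, he⟩ := FiniteMultiplicity.of_not_isUnit (PadicInt.irreducible_p (p := p)).not_isUnit hne
  exact he (key _)

lemma sml_exists_pow (p : ℕ) [hp : Fact p.Prime] (T : Type*) [CommRing T] [Algebra ℤ_[p] T]
    [Module.Finite ℤ_[p] T] (τ : T) (hτ : IsUnit τ) :
    ∃ N, 1 ≤ N ∧ ∃ B : T, τ ^ N = 1 + (p : ℤ_[p]) • B := by
  let I : Ideal ℤ_[p] := Ideal.span {(p : ℤ_[p])}
  have hfin : Finite (ℤ_[p] ⧸ I) := by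
    have h : I = IsLocalRing.maximalIdeal ℤ_[p] := PadicInt.maximalIdeal_eq_span_p.symm
    rw [h]
    exact Finite.of_equiv _ (PadicInt.residueField (p := p)).symm.toEquiv
  have : Finite (T ⧸ (⊤ : Submodule ℤ_[p] T)) := inferInstance
  have hfin2 : Finite (T ⧸ (I • (⊤ : Submodule ℤ_[p] T))) :=
    Submodule.finite_quotient_smul I Module.Finite.fg_top
  obtain ⟨a, b, hab, h⟩ := Finite.exists_ne_map_eq_of_infinite
    (fun k : ℕ => (I • (⊤ : Submodule ℤ_[p] T)).mkQ (τ ^ k))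
  wlog hlt : a < b generalizing a b
  · exact this b a hab.symm h.symm (by omega)
  have h' : τ ^ b - τ ^ a ∈ I • (⊤ : Submodule ℤ_[p] T) := by
    rw [← Submodule.ker_mkQ (I • (⊤ : Submodule ℤ_[p] T)), LinearMap.mem_ker, map_sub, sub_eq_zero]
    exact h.symm
  rw [Submodule.ideal_span_singleton_smul] at h'
  obtain ⟨c, -, hc⟩ := h'
  obtain ⟨u, rfl⟩ := hτ
  refine ⟨b - a, by omega, ↑(u⁻¹ ^ a) * c, ?_⟩
  have hc' : (p : ℤ_[p]) • c = (u : T) ^ b - (u : T) ^ a := hc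
  rw [← mul_smul_comm, hc', mul_sub]
  have e1 : ((u⁻¹ ^ a : Tˣ) : T) * (u : T) ^ a = 1 := by
    rw [← Units.val_pow_eq_pow_val, ← Units.val_mul]; simp
  have e2 : (u : T) ^ b = u ^ a * u ^ (b - a) := by rw [← pow_add]; congr 1; omega
  rw [e2, ← mul_assoc, e1]; ring

lemma sml_core (p : ℕ) [hp : Fact p.Prime] (hp2 : p ≠ 2) (T : Type*) [CommRing T]
    [Algebra ℤ_[p] T] [Module.Finite ℤ_[p] T] (τ : T) (hτ : IsUnit τ) :
    ∃ N, 1 ≤ N ∧ ∀ (l : T →ₗ[ℤ_[p]] ℤ_[p]) (r : ℕ),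
      {x : ℕ | l (τ ^ (r + N * x)) = 0}.Infinite → ∀ x, l (τ ^ (r + N * x)) = 0 := by
  obtain ⟨N, hN, B, hB⟩ := sml_exists_pow p T τ hτ
  refine ⟨N, hN, fun l r h => ?_⟩
  refine sml_hansel p hp2 (fun j => l (τ ^ r * B ^ j)) _ (fun x => ?_) h
  rw [pow_add, pow_mul, hB, add_comm, add_pow, Finset.mul_sum, map_sum]
  refine Finset.sum_congr rfl fun j _ => ?_
  have : τ ^ r * (((p : ℤ_[p]) • B) ^ j * 1 ^ (x - j) * (x.choose j : T)) =
      ((x.choose j : ℤ_[p]) * p ^ j) • (τ ^ r * B ^ j) := by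
    rw [smul_pow, one_pow, mul_one, mul_smul]
    simp only [Algebra.smul_def, map_natCast, map_pow]
    ring
  rw [this, map_smul, smul_eq_mul]

/-- Recurrence over a finite `ℤ_p`-algebra, torsion free. -/
lemma sml_padic (p : ℕ) [hp : Fact p.Prime] (hp2 : p ≠ 2) (S : Type*) [CommRing S]
    [Algebra ℤ_[p] S] [Module.Finite ℤ_[p] S] [Module.IsTorsionFree ℤ_[p] S]
    (U : ℕ → S) (n : ℕ) (hn : 1 ≤ n) (s : Fin n → S) (hs : IsUnit (s ⟨n - 1, by omega⟩))
    (hrec : ∀ m : ℕ, U (m + n) = ∑ i : Fin n, s i * U (m + n - 1 - (i : ℕ))) :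
    ∃ N, 1 ≤ N ∧ ∀ r : ℕ,
      {x : ℕ | U (r + N * x) = 0}.Infinite → ∀ x, U (r + N * x) = 0 := by
  classical
  let q : Polynomial S := ∑ i : Fin n, Polynomial.monomial (n - 1 - (i : ℕ)) (s i)
  let f : Polynomial S := Polynomial.X ^ n - q
  have hqdeg : q.degree < n := by
    rw [← Polynomial.mem_degreeLT]
    refine Submodule.sum_mem _ fun i _ => ?_
    rw [Polynomial.mem_degreeLT]
    refine (Polynomial.degree_monomial_le _ _).trans_lt ?_
    have := i.2
    exact_mod_cast (by omega : n - 1 - (i : ℕ) < n)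
  have hf : f.Monic := Polynomial.monic_X_pow_sub hqdeg
  have hfS : Module.Finite S (Polynomial S ⧸ Ideal.span {f}) := hf.finite_quotient
  have hfT : Module.Finite ℤ_[p] (Polynomial S ⧸ Ideal.span {f}) := Module.Finite.trans S _
  -- the functional
  let L : Polynomial S →ₗ[S] S := (Polynomial.lsum fun m => LinearMap.toSpanSingleton S S (U m))
  have hL : ∀ m a, L (Polynomial.monomial m a) = a * U m := fun m a => by
    simp [L, Polynomial.lsum_apply]
  have hLf : ∀ m, L (Polynomial.X ^ m * f) = 0 := fun m => by
    have : Polynomial.X ^ m * f = Polynomial.monomial (m + n) 1 -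
        ∑ i : Fin n, Polynomial.monomial (m + (n - 1 - (i : ℕ))) (s i) := by
      simp only [f, q, mul_sub, Finset.mul_sum, 
        Polynomial.X_pow_eq_monomial, Polynomial.monomial_mul_monomial, one_mul]
    rw [this, map_sub, map_sum, hL, one_mul, hrec, sub_eq_zero]
    refine Finset.sum_congr rfl fun i _ => ?_
    have := i.2
    rw [hL]; congr 2; omega
  have hLI : ∀ g ∈ Ideal.span {f}, L g = 0 := fun g hg => by
    obtain ⟨h, rfl⟩ := Ideal.mem_span_singleton'.1 hg
    induction h using Polynomial.induction_on' with
    | add a b ha hb => rw [add_mul, map_add, ha (Ideal.mul_mem_left _ _ (Ideal.mem_span_singleton_self f)), hb (Ideal.mul_mem_left _ _ (Ideal.mem_span_singleton_self f)), add_zero]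
    | monomial m a =>
      rw [← Polynomial.C_mul_X_pow_eq_monomial, ← Polynomial.smul_eq_C_mul, smul_mul_assoc,
        map_smul, hLf, smul_zero]
  let l : (Polynomial S ⧸ Ideal.span {f}) →ₗ[S] S :=
    ((Ideal.span {f}).restrictScalars S).liftQ L (fun g hg => hLI g hg)
  let τ : Polynomial S ⧸ Ideal.span {f} := Ideal.Quotient.mk _ Polynomial.X
  have hl : ∀ m, l (τ ^ m) = U m := fun m => by
    have : τ ^ m = Ideal.Quotient.mk _ (Polynomial.monomial m 1) := by
      rw [← Polynomial.X_pow_eq_monomial, map_pow]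
    rw [this]
    have h2 := hL m 1
    rw [one_mul] at h2
    exact h2
  have hq0 : q.coeff 0 = s ⟨n - 1, by omega⟩ := by
    simp only [q, Polynomial.finsetSum_coeff, Polynomial.coeff_monomial]
    rw [Finset.sum_eq_single ⟨n - 1, by omega⟩]
    · simp
    · intro i _ hi
      rw [if_neg]
      intro h
      exact hi (Fin.ext (by have := i.2; simp only; omega))
    · simp
  have hf0 : IsUnit (f.coeff 0) := by
    simp only [f, Polynomial.coeff_sub, Polynomial.coeff_X_pow, hq0]
    rw [if_neg (by omega), zero_sub]
    exact hs.neg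
  have hτ : IsUnit τ := by
    have h1 : τ * Ideal.Quotient.mk _ f.divX
        + Ideal.Quotient.mk (Ideal.span {f}) (Polynomial.C (f.coeff 0)) = 0 := by
      rw [← map_mul, ← map_add, mul_comm, Polynomial.divX_mul_X_add, Ideal.Quotient.eq_zero_iff_mem]
      exact Ideal.mem_span_singleton_self f
    have h2 : IsUnit (τ * Ideal.Quotient.mk _ f.divX) := by
      rw [eq_neg_of_add_eq_zero_left h1]
      exact ((hf0.map Polynomial.C).map (Ideal.Quotient.mk (Ideal.span {f}))).neg
    exact isUnit_of_mul_isUnit_left h2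
  obtain ⟨N, hN, h⟩ := sml_core p hp2 _ τ hτ
  refine ⟨N, hN, fun r hinf x => ?_⟩
  have hfree : Module.Free ℤ_[p] S := inferInstance
  let b := Module.Free.chooseBasis ℤ_[p] S
  refine b.ext_elem fun i => ?_
  have := h ((b.coord i).comp (l.restrictScalars ℤ_[p])) r (hinf.mono fun y hy => ?_) x
  · simpa [hl] using this
  · have hy' : U (r + N * y) = 0 := hy
    simp [hl, hy']

lemma sml_algIndep (p : ℕ) [hp : Fact p.Prime] (k : ℕ) :
    ∃ t : Fin k → ℤ_[p], AlgebraicIndependent ℤ t := by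
  obtain ⟨s, hs⟩ := exists_isTranscendenceBasis ℤ ℤ_[p]
  have hunc : ¬ Countable ℤ_[p] := fun h => by
    have h1 : Countable ℚ_[p] := by
      have : Function.Surjective (fun x : ℤ_[p] × ℤ_[p] => (x.1 : ℚ_[p]) / x.2) := fun z => by
        obtain ⟨a, b, -, hab⟩ := IsFractionRing.div_surjective (A := ℤ_[p]) z
        exact ⟨(a, b), hab⟩
      exact this.countable
    have h2 := continuum_le_cardinal_of_nontriviallyNormedField ℚ_[p]
    have h3 : Cardinal.mk ℚ_[p] ≤ Cardinal.aleph0 := Cardinal.mk_le_aleph0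
    exact absurd (h2.trans h3) (not_le.2 Cardinal.aleph0_lt_continuum)
  have hsinf : s.Infinite := fun hfin => hunc <| by
    have : Countable (Algebra.adjoin ℤ (Set.range ((↑) : s → ℤ_[p]))) := by
      have : Countable s := hfin.countable.to_subtype
      exact (hs.1.aevalEquiv.toEquiv).symm.countable_iff.2 (Cardinal.mk_le_aleph0_iff.1
        (MvPolynomial.cardinalMk_le_max_lift.trans (by simp)))
    have halg := hs.isAlgebraic
    have h4 := Algebra.IsAlgebraic.cardinalMk_le_max
      (Algebra.adjoin ℤ (Set.range ((↑) : s → ℤ_[p]))) ℤ_[p]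
    rw [← Cardinal.mk_le_aleph0_iff]
    exact h4.trans (max_le Cardinal.mk_le_aleph0 le_rfl)
  have := hsinf.to_subtype
  let e : Fin k ↪ s := (Fin.valEmbedding).trans (Infinite.natEmbedding s)
  exact ⟨_, hs.1.comp e e.injective⟩

lemma sml_embed (G : Finset ℂ) : ∃ (p : ℕ) (_ : Fact p.Prime), p ≠ 2 ∧
    ∃ φ : Algebra.adjoin ℚ (G : Set ℂ) →+* AlgebraicClosure ℚ_[p], Function.Injective φ ∧
      ∀ a : Algebra.adjoin ℚ (G : Set ℂ), (a : ℂ) ∈ G → IsIntegral ℤ_[p] (φ a) := by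
  let A := Algebra.adjoin ℚ (G : Set ℂ)
  have : Algebra.FiniteType ℚ A := ⟨(Subalgebra.fg_top _).2 ⟨G, rfl⟩⟩
  obtain ⟨k, g, hg, hint⟩ := exists_integral_inj_algHom_of_fg ℚ A
  let R := MvPolynomial (Fin k) ℤ
  let Q := MvPolynomial (Fin k) ℚ
  let algRQ : Algebra R Q := MvPolynomial.algebraMvPolynomial
  let algQ : Algebra Q A := g.toRingHom.toAlgebra
  let algR : Algebra R A := ((algebraMap Q A).comp (algebraMap R Q)).toAlgebra
  have : IsScalarTower R Q A := IsScalarTower.of_algebraMap_eq fun _ => rfl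
  have hRA : Function.Injective (algebraMap R A) := 
    hg.comp (MvPolynomial.map_injective _ (RingHom.injective_int _))
  have hmul : ∀ a : A, ∃ d : ℤ, d ≠ 0 ∧ IsIntegral R (d • a) := fun a => by
    have ha : IsIntegral Q a := hint a
    obtain ⟨⟨m, hm⟩, h⟩ := IsIntegral.exists_multiple_integral_of_isLocalization
      ((nonZeroDivisors ℤ).map (MvPolynomial.C (σ := Fin k))) a ha
    obtain ⟨d, hd, rfl⟩ := hm
    refine ⟨d, nonZeroDivisors.ne_zero hd, ?_⟩
    have e : (MvPolynomial.C d : R) • a = d • a := by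
      rw [Algebra.smul_def, zsmul_eq_mul]
      congr 1
      simp
    rw [← e]
    exact h
  choose d hd0 hdint using hmul
  -- choose the prime
  let D : ℕ := ∏ a ∈ G.attach, (d ⟨a, Algebra.subset_adjoin a.2⟩).natAbs
  have hD : D ≠ 0 := Finset.prod_ne_zero_iff.2 fun a _ => by simpa using hd0 _
  obtain ⟨p, hpD, hp⟩ := Nat.exists_infinite_primes (D + 3)
  have : Fact p.Prime := ⟨hp⟩
  refine ⟨p, ⟨hp⟩, by omega, ?_⟩
  obtain ⟨t, ht⟩ := sml_algIndep p k
  let K := AlgebraicClosure ℚ_[p]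
  let ψ : R →+* ℤ_[p] := (MvPolynomial.aeval t : R →ₐ[ℤ] ℤ_[p]).toRingHom
  have hψ : Function.Injective ψ := ht
  let algRZ : Algebra R ℤ_[p] := ψ.toAlgebra
  let algRK : Algebra R K := ((algebraMap ℤ_[p] K).comp ψ).toAlgebra
  have : IsScalarTower R ℤ_[p] K := IsScalarTower.of_algebraMap_eq fun _ => rfl
  have hZK : Function.Injective (algebraMap ℤ_[p] K) := by
    rw [IsScalarTower.algebraMap_eq ℤ_[p] ℚ_[p] K]
    exact (algebraMap ℚ_[p] K).injective.comp (IsFractionRing.injective ℤ_[p] ℚ_[p])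
  have hRK : Function.Injective (algebraMap R K) := hZK.comp hψ
  have : FaithfulSMul R K := (faithfulSMul_iff_algebraMap_injective _ _).2 hRK
  have : FaithfulSMul R A := (faithfulSMul_iff_algebraMap_injective _ _).2 hRA
  have : Algebra.IsAlgebraic R A := ⟨fun a => by
    have hdR : ((d a : ℤ) : R) ≠ 0 := Int.cast_ne_zero.2 (hd0 a)
    refine IsAlgebraic.iff_exists_smul_integral.2 ⟨_, hdR, ?_⟩
    rw [Int.cast_smul_eq_zsmul R]
    exact hdint a⟩
  let φ : A →ₐ[R] K := IsAlgClosed.lift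
  refine ⟨φ.toRingHom, ?_, fun a ha => ?_⟩
  · rw [injective_iff_map_eq_zero]
    intro x hx
    by_contra hx0
    refine Ideal.comap_ne_bot_of_algebraic_mem (R := R) (I := RingHom.ker φ) hx0 hx
      (Algebra.IsAlgebraic.isAlgebraic x) ?_
    rw [eq_bot_iff]
    intro y hy
    have hy' : φ (algebraMap R A y) = 0 := hy
    rw [AlgHom.commutes] at hy'
    exact hRK (by rw [hy', map_zero])
  · have h1 : IsIntegral R (φ (d a • a)) := (hdint a).map φ
    have h2 : IsIntegral ℤ_[p] (φ (d a • a)) := h1.tower_top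
    have hu : IsUnit ((d a : ℤ) : ℤ_[p]) := by
      rw [PadicInt.isUnit_iff]
      refine le_antisymm (PadicInt.norm_le_one _) (not_lt.1 fun h => ?_)
      have h5 : p ∣ (d a).natAbs :=
        Int.natCast_dvd.1 ((PadicInt.norm_int_lt_one_iff_dvd (p := p) (d a)).1 h)
      have h6 : (d a).natAbs ∣ D :=
        Finset.dvd_prod_of_mem (fun b : G => (d ⟨b, Algebra.subset_adjoin b.2⟩).natAbs)
          (Finset.mem_attach G ⟨a, ha⟩)
      have := Nat.le_of_dvd (Nat.pos_of_ne_zero hD) (h5.trans h6)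
      omega
    obtain ⟨u, hu⟩ := hu
    have h3 := h2.smul (↑u⁻¹ : ℤ_[p])
    have h4 : (↑u⁻¹ : ℤ_[p]) • φ (d a • a) = φ a := by
      rw [map_zsmul, ← Int.cast_smul_eq_zsmul ℤ_[p], ← hu, smul_smul]
      simp
    rw [h4] at h3
    exact h3

lemma sml_main_unit (U : ℕ → ℂ) (n : ℕ) (hn : 1 ≤ n) (s : Fin n → ℂ)
    (hs : s ⟨n - 1, by omega⟩ ≠ 0)
    (hrec : ∀ m : ℕ, U (m + n) = ∑ i : Fin n, s i * U (m + n - 1 - (i : ℕ))) :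
    ∃ N, 1 ≤ N ∧ ∀ r : ℕ,
      {x : ℕ | U (r + N * x) = 0}.Infinite → ∀ x, U (r + N * x) = 0 := by
  classical
  let G : Finset ℂ := insert (s ⟨n - 1, by omega⟩)⁻¹
    (Finset.univ.image s ∪ (Finset.range n).image U)
  obtain ⟨p, hp, hp2, φ, hφ, hint⟩ := sml_embed G
  let A := Algebra.adjoin ℚ (G : Set ℂ)
  have hGs : ∀ i, s i ∈ G := fun i => by simp [G]
  have hGU : ∀ m < n, U m ∈ G := fun m hm => by
    simp only [G, Finset.mem_insert, Finset.mem_union, Finset.mem_image, Finset.mem_range]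
    exact Or.inr (Or.inr ⟨m, hm, rfl⟩)
  have hGi : (s ⟨n - 1, by omega⟩)⁻¹ ∈ G := by simp [G]
  have hGA : ∀ z ∈ G, z ∈ A := fun z hz => Algebra.subset_adjoin hz
  have hUA : ∀ m, U m ∈ A := fun m => by
    induction m using Nat.strong_induction_on with
    | _ m ih =>
      by_cases hm : m < n
      · exact hGA _ (hGU m hm)
      · obtain ⟨k, rfl⟩ := Nat.exists_eq_add_of_le' (not_lt.1 hm)
        rw [hrec]
        exact Subalgebra.sum_mem _ fun i _ =>
          Subalgebra.mul_mem _ (hGA _ (hGs i)) (ih _ (by omega))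
  let K := AlgebraicClosure ℚ_[p]
  let gens : Set K := (fun a : G => φ ⟨a, hGA _ a.2⟩) '' Set.univ
  let S : Subalgebra ℤ_[p] K := Algebra.adjoin ℤ_[p] gens
  have hSfin : Module.Finite ℤ_[p] S := by
    have h1 : gens.Finite := Set.toFinite _
    have := fg_adjoin_of_finite (R := ℤ_[p]) h1 (by
      rintro _ ⟨a, -, rfl⟩
      exact hint _ a.2)
    exact Module.Finite.iff_fg.2 this
  have hGS : ∀ z (hz : z ∈ G), φ ⟨z, hGA z hz⟩ ∈ S := fun z hz =>
    Algebra.subset_adjoin ⟨⟨z, hz⟩, trivial, rfl⟩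
  have hrec' : ∀ m, φ ⟨U (m + n), hUA _⟩ =
      ∑ i : Fin n, φ ⟨s i, hGA _ (hGs i)⟩ * φ ⟨U (m + n - 1 - (i : ℕ)), hUA _⟩ := fun m => by
    simp only [← map_mul, ← map_sum]
    congr 1
    apply Subtype.ext
    simp [hrec m]
  have hUS : ∀ m, φ ⟨U m, hUA m⟩ ∈ S := fun m => by
    induction m using Nat.strong_induction_on with
    | _ m ih =>
      by_cases hm : m < n
      · exact hGS _ (hGU m hm)
      · obtain ⟨k, rfl⟩ := Nat.exists_eq_add_of_le' (not_lt.1 hm)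
        rw [hrec']
        exact Subalgebra.sum_mem _ fun i _ =>
          Subalgebra.mul_mem _ (hGS _ (hGs i)) (ih _ (by omega))
  have hZK : Function.Injective (algebraMap ℤ_[p] K) := by
    rw [IsScalarTower.algebraMap_eq ℤ_[p] ℚ_[p] K]
    exact (algebraMap ℚ_[p] K).injective.comp (IsFractionRing.injective ℤ_[p] ℚ_[p])
  have : FaithfulSMul ℤ_[p] K := (faithfulSMul_iff_algebraMap_injective _ _).2 hZK
  have htf : Module.IsTorsionFree ℤ_[p] S := inferInstance
  obtain ⟨N, hN, h⟩ := sml_padic p hp2 S (fun m => ⟨φ ⟨U m, hUA m⟩, hUS m⟩) n hn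
    (fun i => ⟨φ ⟨s i, hGA _ (hGs i)⟩, hGS _ (hGs i)⟩) (by
      refine IsUnit.of_mul_eq_one ⟨φ ⟨_, hGA _ hGi⟩, hGS _ hGi⟩ ?_
      apply Subtype.ext
      change φ _ * φ _ = 1
      rw [← map_mul, ← map_one φ]
      congr 1
      apply Subtype.ext
      exact mul_inv_cancel₀ hs) (fun m => by
      apply Subtype.ext
      simp [hrec'])
  have hz : ∀ m, (⟨φ ⟨U m, hUA m⟩, hUS m⟩ : S) = 0 ↔ U m = 0 := fun m => by
    rw [← Subalgebra.coe_eq_zero]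
    change φ _ = 0 ↔ _
    rw [map_eq_zero_iff φ hφ, ← Subalgebra.coe_eq_zero]
  simp only [hz] at h
  exact ⟨N, hN, h⟩

lemma sml_main (n : ℕ) : ∀ (U : ℕ → ℂ) (s : Fin n → ℂ)
    (_ : ∀ m : ℕ, U (m + n) = ∑ i : Fin n, s i * U (m + n - 1 - (i : ℕ))),
    ∃ N M, 1 ≤ N ∧ ∀ r : ℕ, M ≤ r → 
      {x : ℕ | U (r + N * x) = 0}.Infinite → ∀ x, U (r + N * x) = 0 := by
  induction n with
  | zero =>
    intro U s hrec
    refine ⟨1, 0, le_rfl, fun r _ _ x => ?_⟩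
    simpa using hrec (r + 1 * x)
  | succ n ih =>
    intro U s hrec
    by_cases hs : s (Fin.last n) = 0
    · obtain ⟨N, M, hN, h⟩ := ih (fun m => U (m + 1)) (fun i => s i.castSucc) (fun m => by
        have := hrec m
        rw [Fin.sum_univ_castSucc, hs, zero_mul, add_zero] at this
        rw [add_assoc, this]
        refine Finset.sum_congr rfl fun i _ => ?_
        have := i.2
        congr 2
        simp only [Fin.val_castSucc]; omega)
      refine ⟨N, M + 1, hN, fun r hr hinf x => ?_⟩
      obtain ⟨r, rfl⟩ := Nat.exists_eq_add_of_le' (by omega : 1 ≤ r)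
      have e : ∀ x, r + 1 + N * x = r + N * x + 1 := fun x => by ring
      simp only [e] at hinf ⊢
      exact h r (by omega) hinf x
    · obtain ⟨N, hN, h⟩ := sml_main_unit U (n + 1) (by omega) s hs hrec
      exact ⟨N, 0, hN, fun r _ => h r⟩

/-- **Skolem–Mahler–Lech.** The zero set of a complex linear recurrence sequence is the
union of a finite set and finitely many complete arithmetic progressions. -/
theorem skolem_mahler_lech (U : ℕ → ℂ) (n : ℕ) (hn : 1 ≤ n) (s : Fin n → ℂ)
    (hrec : ∀ m : ℕ, U (m + n) = ∑ i : Fin n, s i * U (m + n - 1 - (i : ℕ))) :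
    ∃ (F : Finset ℕ) (k : ℕ) (f g : Fin k → ℕ),
      (∀ i, 1 ≤ g i) ∧
      {m : ℕ | U m = 0} = ↑F ∪ ⋃ i : Fin k, Set.range (fun h : ℕ => f i + g i * h) := by
  classical
  obtain ⟨N, M, hN, h⟩ := sml_main n U s hrec
  let I : Finset ℕ := (Finset.Ico M (M + N)).filter fun r => {x : ℕ | U (r + N * x) = 0}.Infinite
  let E : Set ℕ := {m | U m = 0 ∧ ∀ r ∈ I, ∀ x, m ≠ r + N * x}
  have hE : E.Finite := by
    have hsub : E ⊆ (Set.Iio M) ∪ ⋃ r ∈ (Finset.Ico M (M + N)) \ I,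
        (fun x => r + N * x) '' {x : ℕ | U (r + N * x) = 0} := by
      rintro m ⟨hm, hmI⟩
      by_cases hlt : m < M
      · exact Or.inl hlt
      refine Or.inr ?_
      have h1 : m = (M + (m - M) % N) + N * ((m - M) / N) := by
        have := Nat.mod_add_div (m - M) N; omega
      have h2 : (m - M) % N < N := Nat.mod_lt _ hN
      simp only [Set.mem_iUnion]
      refine ⟨M + (m - M) % N, ?_, (m - M) / N, ?_, h1.symm⟩
      · rw [Finset.mem_sdiff, Finset.mem_Ico]
        exact ⟨by omega, fun hI => hmI _ hI _ h1⟩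
      · change U _ = 0
        rw [← h1]; exact hm
    refine Set.Finite.subset ((Set.finite_Iio M).union
      (Set.Finite.biUnion (Finset.finite_toSet _) fun r hr => ?_)) hsub
    have hr' := Finset.mem_sdiff.1 (Finset.mem_coe.1 hr)
    refine Set.Finite.image _ (Set.not_infinite.1 fun hi => hr'.2 ?_)
    exact Finset.mem_filter.2 ⟨hr'.1, hi⟩
  refine ⟨hE.toFinset, I.card, fun i => (I.equivFin.symm i : ℕ), fun _ => N, fun _ => hN, ?_⟩
  ext m
  simp only [Set.mem_setOf_eq, Set.mem_union, Set.mem_iUnion, Set.mem_range,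
    Set.Finite.coe_toFinset]
  constructor
  · intro hm
    by_cases hex : ∀ r ∈ I, ∀ x, m ≠ r + N * x
    · exact Or.inl ⟨hm, hex⟩
    · push Not at hex
      obtain ⟨r, hr, x, hx⟩ := hex
      exact Or.inr ⟨I.equivFin ⟨r, hr⟩, x, by simp [hx]⟩
  · rintro (hm | ⟨i, x, rfl⟩)
    · exact hm.1
    · have hi := Finset.mem_filter.1 (I.equivFin.symm i).2
      exact h _ (Finset.mem_Ico.1 hi.1).1 hi.2 x
end

section
/- Let k ≥ 1, let a₁, …, a_k ∈ ℂ be nonzero, and let α₁, …, α_k ∈ ℂ be nonzero and pairwise distinct. If the equation a₁·α₁^m + a₂·α₂^m + ⋯ + a_k·α_k^m = 0 has infinitely many solutions m ∈ ℕ, then the index set {1, …, k} can be partitioned into disjoint subsets, each containing at least two elements, such that for any two indices i, j lying in the same subset, the ratio αᵢ/αⱼ is a root of unity. -/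
open Filter Topology

theorem expRadius_pos (p : ℕ) [Fact p.Prime] (C : Type*) [NontriviallyNormedField C]
    [NormedAlgebra ℚ_[p] C] : 0 < (NormedSpace.expSeries ℚ_[p] C).radius := by
  have hp : (0:ℝ) < p := by exact_mod_cast (Fact.out : p.Prime).pos
  have hp1 : (1:ℝ) ≤ p := by exact_mod_cast (Fact.out : p.Prime).one_le
  have key : ∀ n, ‖NormedSpace.expSeries ℚ_[p] C n‖ * (((p:NNReal)⁻¹ : NNReal) : ℝ) ^ n ≤ 1 := by
    intro n
    have h1 : ‖NormedSpace.expSeries ℚ_[p] C n‖ ≤ ‖((n.factorial : ℚ_[p])⁻¹)‖ := by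
      unfold NormedSpace.expSeries
      rw [norm_smul]
      simp
    have h2 : ‖((n.factorial : ℚ_[p])⁻¹)‖ ≤ (p:ℝ)^n := by
      rw [norm_inv, Padic.norm_eq_zpow_neg_valuation (by exact_mod_cast n.factorial_ne_zero),
        Padic.valuation_natCast, zpow_neg, inv_inv, zpow_natCast]
      refine pow_le_pow_right₀ hp1 ?_
      have := sub_one_mul_padicValNat_factorial (p := p) n
      have h2 := (Fact.out : p.Prime).two_le
      have : 1 * padicValNat p n.factorial ≤ (p-1) * padicValNat p n.factorial :=
        Nat.mul_le_mul_right _ (by omega)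
      omega
    calc _ ≤ (p:ℝ)^n * ((p:ℝ)⁻¹)^n := by
            gcongr
            · exact h1.trans h2
            · simp
      _ = 1 := by rw [← mul_pow, mul_inv_cancel₀ hp.ne', one_pow]
  have := FormalMultilinearSeries.le_radius_of_bound _ 1 key
  refine lt_of_lt_of_le ?_ this
  rw [ENNReal.coe_pos, ← NNReal.coe_pos]
  push_cast
  positivity

theorem exists_interp (p : ℕ) [Fact p.Prime] (C : Type*) [NontriviallyNormedField C]
    [NormedAlgebra ℚ_[p] C] [CompleteSpace C] :
    ∃ ε > (0:ℝ), ∀ γ : C, ‖γ - 1‖ < ε → ∃ g : ℚ_[p] → C,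
      (∀ x, ‖x‖ ≤ 1 → AnalyticAt ℚ_[p] g x) ∧ ∀ n : ℕ, g n = γ ^ n := by
  have hr := expRadius_pos p C
  have hd := hasStrictFDerivAt_exp_zero_of_radius_pos hr
  have hd' : HasStrictFDerivAt (NormedSpace.exp : C → C)
    ((ContinuousLinearEquiv.refl ℚ_[p] C : C ≃L[ℚ_[p]] C) : C →L[ℚ_[p]] C) 0 := hd
  have hmap := hd'.map_nhds_eq_of_equiv
  rw [NormedSpace.exp_zero] at hmap
  have hball : Metric.eball (0:C) (NormedSpace.expSeries ℚ_[p] C).radius ∈ 𝓝 (0:C) :=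
    Metric.eball_mem_nhds _ hr
  have := image_mem_map (m := (NormedSpace.exp : C → C)) hball
  rw [hmap, Metric.mem_nhds_iff] at this
  obtain ⟨ε, hε, hsub⟩ := this
  refine ⟨ε, hε, fun γ hγ => ?_⟩
  obtain ⟨l, hl, rfl⟩ := hsub (by simpa [dist_eq_norm] using hγ)
  have hxl : ∀ x : ℚ_[p], ‖x‖ ≤ 1 → x • l ∈ Metric.eball (0:C) (NormedSpace.expSeries ℚ_[p] C).radius := by
    intro x hx
    rw [Metric.mem_eball, edist_zero_right] at hl ⊢
    refine lt_of_le_of_lt ?_ hl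
    rw [enorm_le_iff_norm_le, norm_smul]
    exact mul_le_of_le_one_left (norm_nonneg _) hx
  refine ⟨fun x => NormedSpace.exp (x • l), fun x hx => ?_, fun n => ?_⟩
  · have h1 := NormedSpace.analyticAt_exp_of_mem_ball (𝕂 := ℚ_[p]) (x • l) (hxl x hx)
    exact AnalyticAt.fun_comp (f := fun x : ℚ_[p] => x • l) h1 (analyticAt_id.smul analyticAt_const)
  · have hn : ∀ n : ℕ, ‖(n : ℚ_[p])‖ ≤ 1 := fun n => by
      simpa using Padic.norm_int_le_one (p := p) n
    induction n with
    | zero => simp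
    | succ n ih =>
      show NormedSpace.exp _ = _
      rw [Nat.cast_succ, add_smul, NormedSpace.exp_add_of_mem_ball (hxl _ (hn n)) (by simpa using hl),
        pow_succ, ← ih, one_smul]

theorem exists_AP_of_analytic (p : ℕ) [Fact p.Prime] (C : Type*) [NontriviallyNormedField C]
    [NormedAlgebra ℚ_[p] C] (G : ℚ_[p] → C) (hG : ∀ x, ‖x‖ ≤ 1 → AnalyticAt ℚ_[p] G x)
    (hinf : {n : ℕ | G n = 0}.Infinite) :
    ∃ n₀ d : ℕ, 0 < d ∧ ∀ k : ℕ, G ((n₀ + d * k : ℕ)) = 0 := by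
  have hn : ∀ n : ℕ, ‖(n : ℚ_[p])‖ ≤ 1 := fun n => by
      simpa using Padic.norm_int_le_one (p := p) n
  have hcomp : IsCompact (Metric.closedBall (0:ℚ_[p]) 1) := isCompact_closedBall _ _
  have hinf' : ((fun n : ℕ => (n : ℚ_[p])) '' {n : ℕ | G n = 0}).Infinite :=
    hinf.image (Nat.cast_injective.injOn)
  obtain ⟨t, ht, hacc⟩ := hinf'.exists_accPt_of_subset_isCompact hcomp (by
    rintro _ ⟨n, -, rfl⟩
    simpa using hn n)
  have ht' : ‖t‖ ≤ 1 := by simpa using ht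
  have hfr : ∃ᶠ y in 𝓝[≠] t, G y = 0 := by
    rw [accPt_iff_frequently_nhdsNE] at hacc
    refine hacc.mono ?_
    rintro _ ⟨n, hn, rfl⟩
    exact hn
  have hev : ∀ᶠ y in 𝓝 t, G y = 0 := (hG t ht').frequently_zero_iff_eventually_zero.mp hfr
  obtain ⟨ε, hε, hb⟩ := Metric.eventually_nhds_iff_ball.mp hev
  have : ∃ n₀ : ℕ, dist (n₀ : ℚ_[p]) t < ε := by
    rw [accPt_iff_frequently] at hacc
    obtain ⟨y, hy, -, n, -, rfl⟩ := (hacc.and_eventually (Metric.ball_mem_nhds t hε)).exists.imp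
      (fun y h => (⟨h.2, h.1⟩ : _ ∧ _))
    exact ⟨n, hy⟩
  obtain ⟨n₀, hn₀⟩ := this
  have hp : (1:ℝ) < p := by exact_mod_cast (Fact.out : p.Prime).one_lt
  obtain ⟨N, hN⟩ := exists_pow_lt_of_lt_one hε (inv_lt_one_of_one_lt₀ hp)
  refine ⟨n₀, p ^ N, pow_pos (Fact.out : p.Prime).pos _, fun k => hb _ ?_⟩
  rw [Metric.mem_ball, dist_eq_norm]
  have : ((n₀ + p ^ N * k : ℕ) : ℚ_[p]) - t = (n₀ - t) + p ^ N * k := by push_cast; ring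
  rw [this]
  refine (Padic.nonarchimedean _ _).trans_lt (max_lt (by rwa [← dist_eq_norm]) ?_)
  rw [norm_mul, norm_pow, Padic.norm_p]
  exact (mul_le_of_le_one_right (by positivity) (hn k)).trans_lt hN

theorem exists_pow_near_one (p : ℕ) [Fact p.Prime] (C : Type*) [NontriviallyNormedField C]
    [NormedAlgebra ℚ_[p] C] {k : ℕ} (α : Fin k → C) (h1 : ∀ i, ‖α i‖ = 1)
    (hint : ∀ i, IsIntegral ℚ_[p] (α i)) (ε : ℝ) (hε : 0 < ε) :
    ∃ d : ℕ, 0 < d ∧ ∀ i, ‖α i ^ d - 1‖ < ε := by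
  let A : Subalgebra ℚ_[p] C := Algebra.adjoin ℚ_[p] (Set.range α)
  have hfg : (Subalgebra.toSubmodule A).FG := 
    fg_adjoin_of_finite (Set.finite_range α) (by rintro _ ⟨i, rfl⟩; exact hint i)
  let W := Subalgebra.toSubmodule A
  have : FiniteDimensional ℚ_[p] W := Module.Finite.iff_fg.mpr hfg
  have : ProperSpace W := FiniteDimensional.proper ℚ_[p] W
  let u : ℕ → Fin k → W := fun n i => ⟨α i ^ n, A.pow_mem (Algebra.subset_adjoin ⟨i, rfl⟩) n⟩
  have hu : ∀ n, u n ∈ Metric.closedBall (0 : Fin k → W) 1 := by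
    intro n
    rw [mem_closedBall_zero_iff, pi_norm_le_iff_of_nonneg zero_le_one]
    intro i
    show ‖α i ^ n‖ ≤ 1
    rw [norm_pow, h1, one_pow]
  obtain ⟨w, -, φ, hφ, hlim⟩ := (isCompact_closedBall (0 : Fin k → W) 1).tendsto_subseq hu
  have hc := hlim.cauchySeq
  rw [Metric.cauchySeq_iff] at hc
  obtain ⟨N, hN⟩ := hc ε hε
  have hlt := hφ (Nat.lt_succ_self N)
  refine ⟨φ (N+1) - φ N, Nat.sub_pos_of_lt hlt, fun i => ?_⟩
  have h2 := hN (N+1) (by simp) N le_rfl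
  rw [dist_pi_lt_iff hε] at h2
  have h3 : ‖α i ^ φ (N+1) - α i ^ φ N‖ < ε := by
    have := h2 i
    rw [dist_eq_norm] at this
    exact this
  have h4 : α i ^ φ (N+1) - α i ^ φ N = α i ^ φ N * (α i ^ (φ (N+1) - φ N) - 1) := by
    rw [mul_sub, ← pow_add, Nat.add_sub_cancel' hlt.le, mul_one]
  rw [h4, norm_mul, norm_pow, h1, one_pow, one_mul] at h3
  exact h3

theorem exists_AP_padic (p : ℕ) [Fact p.Prime] (C : Type*) [NontriviallyNormedField C]
    [NormedAlgebra ℚ_[p] C] [CompleteSpace C] {k : ℕ} (a α : Fin k → C) (h1 : ∀ i, ‖α i‖ = 1)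
    (hint : ∀ i, IsIntegral ℚ_[p] (α i))
    (hinf : {m : ℕ | ∑ i : Fin k, a i * (α i) ^ m = 0}.Infinite) :
    ∃ n₀ d : ℕ, 0 < d ∧ ∀ l : ℕ, ∑ i : Fin k, a i * (α i) ^ (n₀ + d * l) = 0 := by
  obtain ⟨ε, hε, hg⟩ := exists_interp p C
  obtain ⟨d, hd, hdε⟩ := exists_pow_near_one p C α h1 hint ε hε
  choose g hga hgn using fun i => hg (α i ^ d) (hdε i)
  -- pigeonhole
  have : ∃ c : ℕ, {n : ℕ | ∑ i : Fin k, a i * (α i) ^ (c + d * n) = 0}.Infinite := by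
    by_contra! hcon
    apply hinf
    have hfin : (⋃ c ∈ Set.Iio d, (fun n => c + d * n) ''
        {n : ℕ | ∑ i : Fin k, a i * (α i) ^ (c + d * n) = 0}).Finite :=
      (Set.finite_Iio d).biUnion fun c _ => (hcon c).image _
    refine hfin.subset fun m hm => ?_
    simp only [Set.mem_iUnion]
    refine ⟨m % d, Nat.mod_lt _ hd, m / d, ?_, Nat.mod_add_div m d⟩
    show _ = _
    rw [Nat.mod_add_div]
    exact hm
  obtain ⟨c, hc⟩ := this
  have hG : ∀ n : ℕ, ∑ i, a i * α i ^ c * g i n = ∑ i : Fin k, a i * (α i) ^ (c + d * n) := by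
    intro n
    refine Finset.sum_congr rfl fun i _ => ?_
    rw [hgn, pow_add, pow_mul, mul_assoc]
  obtain ⟨n₀, e, he, hz⟩ := exists_AP_of_analytic p C (fun x => ∑ i, a i * α i ^ c * g i x)
    (fun x hx => Finset.analyticAt_fun_sum _ fun i _ => analyticAt_const.mul (hga i x hx))
    (by simpa only [hG] using hc)
  refine ⟨c + d * n₀, d * e, Nat.mul_pos hd he, fun l => ?_⟩
  have := hz l
  simp only [hG] at this
  rw [← this]
  refine Finset.sum_congr rfl fun i _ => ?_
  ring_nf

theorem norm_le_one_of_integral {P L : Type*} [CommRing P] [NormedField L] [IsUltrametricDist L]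
    [Algebra P L] (h : ∀ r : P, ‖algebraMap P L r‖ ≤ 1) {z : L} (hz : IsIntegral P z) :
    ‖z‖ ≤ 1 := by
  let v : Valuation L NNReal := NormedField.valuation
  have hv : ∀ w, w ∈ v.integer ↔ ‖w‖ ≤ 1 := fun w => Iff.rfl
  let f' : P →+* v.integer := (algebraMap P L).codRestrict v.integer (fun r => (hv _).2 (h r))
  obtain ⟨q, hq, hqz⟩ := hz
  have : IsIntegral v.integer z := by
    refine ⟨q.map f', hq.map _, ?_⟩
    rw [Polynomial.eval₂_map]
    exact hqz
  exact (hv z).1 ((Valuation.integer.integers v).mem_of_integral this)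

theorem exists_unit_embedding_aux {P L ι : Type*} [CommRing P] [IsDomain P] [Algebra P ℂ]
    [Module.IsTorsionFree P ℂ] [Algebra.IsAlgebraic P ℂ]
    [NormedField L] [IsUltrametricDist L] [IsAlgClosed L] [Algebra P L] [Module.IsTorsionFree P L]
    (hle : ∀ r : P, ‖algebraMap P L r‖ ≤ 1) (D : P) (hD : ‖algebraMap P L D‖ = 1)
    (z : ι → ℂ) (hz : ∀ i, z i ≠ 0) (h1 : ∀ i, IsIntegral P (D • z i))
    (h2 : ∀ i, IsIntegral P (D • (z i)⁻¹)) :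
    ∃ φ : ℂ →+* L, ∀ i, ‖φ (z i)‖ = 1 := by
  let φ : ℂ →ₐ[P] L := IsAlgClosed.lift
  have key : ∀ w, IsIntegral P (D • w) → ‖φ w‖ ≤ 1 := by
    intro w hw
    have := norm_le_one_of_integral hle (hw.map φ)
    rwa [map_smul, Algebra.smul_def, norm_mul, hD, one_mul] at this
  refine ⟨φ.toRingHom, fun i => le_antisymm (key _ (h1 i)) ?_⟩
  have h3 := key _ (h2 i)
  rw [map_inv₀, norm_inv] at h3
  have h4 : 0 < ‖φ (z i)‖ := norm_pos_iff.2 ((map_ne_zero φ).2 (hz i))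
  exact (inv_le_one₀ h4).1 h3

theorem exists_algInd_padicInt (p : ℕ) [Fact p.Prime] (ι : Type) (hι : Cardinal.mk ι ≤ Cardinal.continuum) :
    ∃ y : ι → ℤ_[p], AlgebraicIndependent ℤ y := by
  obtain ⟨s, hs⟩ := exists_isTranscendenceBasis ℤ ℤ_[p]
  have hc : Cardinal.continuum ≤ Cardinal.mk ℤ_[p] := by
    rw [← IsFractionRing.cardinalMk ℤ_[p] ℚ_[p]]
    exact continuum_le_cardinal_of_nontriviallyNormedField ℚ_[p]
  have := hs.isAlgebraic
  have h1 := Algebra.IsAlgebraic.cardinalMk_le_max (Algebra.adjoin ℤ (Set.range (Subtype.val : s → ℤ_[p]))) ℤ_[p]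
  rw [← Cardinal.mk_congr hs.1.aevalEquiv.toEquiv] at h1
  have h2 : Cardinal.mk (MvPolynomial s ℤ) ≤ _ := MvPolynomial.cardinalMk_le_max
  have h3 : Cardinal.continuum ≤ Cardinal.mk s := by
    by_contra! hlt
    have h4 := (hc.trans h1).trans (max_le_max_right _ h2)
    have h5 := Cardinal.aleph0_lt_continuum.{0}
    simp [h5.not_ge, hlt.not_ge] at h4
  obtain ⟨e⟩ := Cardinal.le_def _ _ |>.1 (hι.trans h3)
  exact ⟨_, hs.1.comp e e.injective⟩

theorem exists_unit_embedding {k : ℕ} (α : Fin k → ℂ) (hα : ∀ i, α i ≠ 0) :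
    ∃ (p : ℕ) (_ : Fact p.Prime) (φ : ℂ →+* PadicAlgCl p), ∀ i, ‖φ (α i)‖ = 1 := by
  classical
  obtain ⟨ι, hx⟩ := exists_isTranscendenceBasis ℤ ℂ
  have hcard : Cardinal.mk ι ≤ Cardinal.continuum := by
    rw [← Cardinal.mk_complex]; exact Cardinal.mk_subtype_le _
  have halg := hx.isAlgebraic
  let P := Algebra.adjoin ℤ (Set.range (Subtype.val : ι → ℂ))
  obtain ⟨D, hD0, hD⟩ := Algebra.IsAlgebraic.exists_integral_multiples P
    (Finset.univ.image α ∪ Finset.univ.image (fun i => (α i)⁻¹))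
  let D' : MvPolynomial ι ℤ := hx.1.repr D
  have hD' : D' ≠ 0 := by
    intro h
    apply hD0
    have := hx.1.aeval_repr D
    rw [show hx.1.repr D = 0 from h, map_zero] at this
    exact Subtype.ext this.symm
  obtain ⟨u, hu⟩ : ∃ u : ι → ℤ, MvPolynomial.eval u D' ≠ 0 := by
    by_contra! hcon
    exact hD' (MvPolynomial.funext fun u => by rw [hcon, map_zero])
  obtain ⟨p, hpgt, hp⟩ := Nat.exists_infinite_primes ((MvPolynomial.eval u D').natAbs + 1)
  have : Fact p.Prime := ⟨hp⟩
  obtain ⟨y, hy⟩ := exists_algInd_padicInt p ι hcard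
  have hy2 : AlgebraicIndependent ℤ (fun i => (u i : ℤ_[p]) + p * y i) := by
    have := hy.polynomial_aeval_of_transcendental
      (f := fun i => Polynomial.C (u i) + Polynomial.C (p : ℤ) * Polynomial.X) (fun i => by
        have h0 : (p:ℤ) ≠ 0 := by exact_mod_cast hp.ne_zero
        have hdeg : (Polynomial.C (u i) + Polynomial.C (p : ℤ) * Polynomial.X).natDegree = 1 := by
          rw [add_comm]; exact Polynomial.natDegree_linear h0
        have := (Polynomial.transcendental_X ℤ).aeval
          (Polynomial.C (u i) + Polynomial.C (p : ℤ) * Polynomial.X) (by rw [hdeg]; simp) (by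
            apply mem_nonZeroDivisors_of_ne_zero
            rw [Polynomial.leadingCoeff_ne_zero]
            intro h
            rw [h] at hdeg
            simp at hdeg)
        simpa using this)
    simpa using this
  let ψ : P →+* PadicAlgCl p := ((algebraMap ℚ_[p] (PadicAlgCl p)).comp
    (algebraMap ℤ_[p] ℚ_[p])).comp
    ((MvPolynomial.aeval (fun i => (u i : ℤ_[p]) + p * y i)).toRingHom.comp
      (hx.1.repr : P →ₐ[ℤ] MvPolynomial ι ℤ).toRingHom)
  have hψ : ∀ r, ψ r = algebraMap ℚ_[p] (PadicAlgCl p)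
    ((MvPolynomial.aeval (fun i => (u i : ℤ_[p]) + p * y i) (hx.1.repr r) : ℤ_[p]) : ℚ_[p]) :=
    fun r => rfl
  have hnorm : ∀ r, ‖ψ r‖ = ‖MvPolynomial.aeval (fun i => (u i : ℤ_[p]) + p * y i) (hx.1.repr r)‖ := by
    intro r
    rw [hψ, norm_algebraMap']
    rfl
  have hinj : Function.Injective ψ := by
    refine ((algebraMap ℚ_[p] (PadicAlgCl p)).injective.comp
      (IsFractionRing.injective ℤ_[p] ℚ_[p])).comp ?_
    have hi : Function.Injective (MvPolynomial.aeval (R := ℤ) (fun i => (u i : ℤ_[p]) + p * y i)) := hy2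
    exact hi.comp hx.1.aevalEquiv.symm.injective
  let _ : Algebra P (PadicAlgCl p) := ψ.toAlgebra
  have : FaithfulSMul P (PadicAlgCl p) := (faithfulSMul_iff_algebraMap_injective _ _).2 hinj
  have : Module.IsTorsionFree P (PadicAlgCl p) := inferInstance
  refine ⟨p, ⟨hp⟩, exists_unit_embedding_aux (P := P) (fun r => ?_) D ?_ α hα (fun i => ?_) (fun i => ?_)⟩
  · show ‖ψ r‖ ≤ 1
    rw [hnorm]
    exact PadicInt.norm_le_one _
  · show ‖ψ D‖ = 1
    rw [hnorm, ← PadicInt.isUnit_iff]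
    by_contra hnu
    have hm : MvPolynomial.aeval (fun i => (u i : ℤ_[p]) + p * y i) D' ∈
        RingHom.ker (PadicInt.toZMod (p := p)) := by
      rw [PadicInt.ker_toZMod]
      exact hnu
    rw [RingHom.mem_ker] at hm
    have h5 : PadicInt.toZMod (p := p) (MvPolynomial.aeval (fun i => (u i : ℤ_[p]) + p * y i) D')
        = ((MvPolynomial.eval u D' : ℤ) : ZMod p) := by
      have : (PadicInt.toZMod (p := p)).comp
          (MvPolynomial.aeval (R := ℤ) (fun i => (u i : ℤ_[p]) + p * y i)).toRingHom =
          (Int.castRingHom (ZMod p)).comp (MvPolynomial.eval u) := by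
        apply MvPolynomial.ringHom_ext
        · intro r; simp
        · intro i; simp
      exact RingHom.congr_fun this D'
    rw [h5, ZMod.intCast_zmod_eq_zero_iff_dvd, Int.natCast_dvd] at hm
    exact absurd (Nat.le_of_dvd (Int.natAbs_pos.2 hu) hm) (by omega)
  · exact hD _ (by simp)
  · exact hD _ (by simp)

theorem exists_AP {k : ℕ} (a α : Fin k → ℂ) (hα : ∀ i, α i ≠ 0)
    (hinf : {m : ℕ | ∑ i : Fin k, a i * (α i) ^ m = 0}.Infinite) :
    ∃ n₀ d : ℕ, 0 < d ∧ ∀ l : ℕ, ∑ i : Fin k, a i * (α i) ^ (n₀ + d * l) = 0 := by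
  obtain ⟨p, hp, φ, hφ⟩ := exists_unit_embedding α hα
  let Φ : ℂ →+* ℂ_[p] := (algebraMap (PadicAlgCl p) ℂ_[p]).comp φ
  have hΦ : ∀ m : ℕ, ∑ i, Φ (a i) * Φ (α i) ^ m = 0 ↔ ∑ i, a i * α i ^ m = 0 := by
    intro m
    rw [← map_eq_zero Φ]
    simp only [map_sum, map_mul, map_pow]
  obtain ⟨n₀, d, hd, h⟩ := exists_AP_padic p ℂ_[p] (fun i => Φ (a i)) (fun i => Φ (α i))
    (fun i => (PadicComplex.norm_extends p (φ (α i))).trans (hφ i))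
    (fun i => (Algebra.IsIntegral.isIntegral (R := ℚ_[p]) (φ (α i))).algebraMap)
    (by simpa only [hΦ] using hinf)
  exact ⟨n₀, d, hd, fun l => (hΦ _).1 (h l)⟩

theorem exists_ne_of_power_sums {k : ℕ} (b β : Fin k → ℂ) (hb : ∀ i, b i ≠ 0)
    (h : ∀ l : ℕ, ∑ i, b i * β i ^ l = 0) (i : Fin k) : ∃ j, j ≠ i ∧ β j = β i := by
  by_contra! hcon
  have hpoly : ∀ q : Polynomial ℂ, ∑ i, b i * q.eval (β i) = 0 := by
    intro q
    induction q using Polynomial.induction_on' with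
    | add p q hp hq => simp [mul_add, Finset.sum_add_distrib, hp, hq]
    | monomial n c =>
      have : ∀ i, b i * (Polynomial.monomial n c).eval (β i) = c * (b i * β i ^ n) := by
        intro i; rw [Polynomial.eval_monomial]; ring
      simp_rw [this, ← Finset.mul_sum, h, mul_zero]
  have := hpoly (∏ j ∈ Finset.univ.erase i, (Polynomial.X - Polynomial.C (β j)))
  rw [Finset.sum_eq_single i] at this
  · rcases mul_eq_zero.1 this with h | h
    · exact hb i h
    · rw [Polynomial.eval_prod, Finset.prod_eq_zero_iff] at h
      obtain ⟨j, hj, h⟩ := h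
      refine hcon j (Finset.ne_of_mem_erase hj) ?_
      simp only [Polynomial.eval_sub, Polynomial.eval_X, Polynomial.eval_C] at h
      exact (sub_eq_zero.1 h).symm
  · intro j _ hj
    rw [Polynomial.eval_prod, Finset.prod_eq_zero (Finset.mem_erase.2 ⟨hj, Finset.mem_univ j⟩),
      mul_zero]
    simp
  · simp

theorem skolem_mahler_lech_corollary (k : ℕ) (hk : 1 ≤ k)
    (a α : Fin k → ℂ) (ha : ∀ i, a i ≠ 0) (hα : ∀ i, α i ≠ 0)
    (hdist : Function.Injective α)
    (hinf : {m : ℕ | ∑ i : Fin k, a i * (α i) ^ m = 0}.Infinite) :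
    ∃ P : Finset (Finset (Fin k)),
      (∀ i : Fin k, ∃! p : Finset (Fin k), p ∈ P ∧ i ∈ p) ∧
      (∀ p ∈ P, 2 ≤ p.card) ∧
      (∀ p ∈ P, ∀ i ∈ p, ∀ j ∈ p, IsRootOfUnity (α i / α j)) := by
  classical
  obtain ⟨n₀, d, hd, hz⟩ := exists_AP a α hα hinf
  have hex := exists_ne_of_power_sums (fun i => a i * α i ^ n₀) (fun i => α i ^ d)
    (fun i => mul_ne_zero (ha i) (pow_ne_zero _ (hα i))) (fun l => by
      rw [← hz l]
      refine Finset.sum_congr rfl fun i _ => ?_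
      rw [pow_add, pow_mul, mul_assoc])
  let cl : Fin k → Finset (Fin k) := fun i => Finset.univ.filter fun j => α j ^ d = α i ^ d
  have hcl : ∀ i j, j ∈ cl i ↔ α j ^ d = α i ^ d := fun i j => by simp [cl]
  refine ⟨Finset.univ.image cl, fun i => ⟨cl i, ⟨by simp, (hcl _ _).2 rfl⟩, ?_⟩, ?_, ?_⟩
  · rintro q ⟨hq, hi⟩
    obtain ⟨j, -, rfl⟩ := Finset.mem_image.1 hq
    rw [hcl] at hi
    ext l
    rw [hcl, hcl, hi]
  · intro q hq
    obtain ⟨i, -, rfl⟩ := Finset.mem_image.1 hq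
    obtain ⟨j, hj, hji⟩ := hex i
    exact Finset.one_lt_card.2 ⟨j, (hcl _ _).2 hji, i, (hcl _ _).2 rfl, hj⟩
  · intro q hq i hi j hj
    obtain ⟨l, -, rfl⟩ := Finset.mem_image.1 hq
    rw [hcl] at hi hj
    refine ⟨d, hd, ?_⟩
    rw [div_pow, hi, hj, div_self (pow_ne_zero _ (hα l))]
end
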